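/- arXiv:2109.09544 — 2 statements merged into one kernel-verified Lean document; each statement's English description precedes it below -/
import Mathlib

section
/- In the setting of the base large-deviations theorem (ergodic ν₀, observable φ bounded, continuous and depending on finitely many coordinates), the same exponential estimate holds with the centering taken at the fixed measure: for every ε > 0 there exist δ > 0, n̄ ∈ ℕ and c > 0 such that for every compactly supported Borel probability measure ν on Ω with W₁(ν, ν₀) < δ, every θ ∈ 𝕋^d and every n ≥ n̄, ν^ℤ{ω ∈ X : |(1/n) ∑_{j=0}^{n−1} φ(f^j(ω, θ)) − ∫ φ d(ν₀^ℤ × m)| ≥ ε} < e^{−cn}. -/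
open MeasureTheory Filter Topology

noncomputable section

/-- The `d`-dimensional torus `𝕋^d = (ℝ/ℤ)^d`; `volume` on it is the Haar
probability measure `m`. -/
abbrev Td (d : ℕ) : Type := Fin d → AddCircle (1 : ℝ)

instance : IsProbabilityMeasure (volume : Measure (AddCircle (1:ℝ))) :=
  ⟨by rw [AddCircle.measure_univ]; norm_num⟩

/-- `P` is the Bernoulli product measure `ν^ι` on `ι → Ω`. -/
def IsBernoulli {Ω ι : Type*} [MeasurableSpace Ω] (ν : Measure Ω)
    (P : Measure (ι → Ω)) : Prop :=
  IsProbabilityMeasure P ∧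
    ∀ (s : Finset ι) (E : ι → Set Ω), (∀ i, MeasurableSet (E i)) →
      P {ω | ∀ i ∈ s, ω i ∈ E i} = ∏ i ∈ s, ν (E i)

/-- The two-sided Bernoulli shift `(σω)_n = ω_{n+1}`. -/
def shiftZ (Ω : Type*) : (ℤ → Ω) → (ℤ → Ω) := fun ω n => ω (n + 1)

/-- The Wasserstein (Kantorovich-Rubinstein) distance
`W₁(ν, ν') = sup {∫ g d(ν − ν') : g Lipschitz with constant ≤ 1}`. -/
def W1 {M : Type*} [MeasurableSpace M] [MetricSpace M]
    (ν ν' : Measure M) : ℝ :=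
  sSup {r | ∃ g : M → ℝ, LipschitzWith 1 g ∧
    r = (∫ x, g x ∂ν) - ∫ x, g x ∂ν'}

section Bernoulli

variable {Ω ι : Type*} [MeasurableSpace Ω]

theorem IsBernoulli.eq_infinitePi {ν : Measure Ω} [IsProbabilityMeasure ν]
    {P : Measure (ι → Ω)} (hP : IsBernoulli ν P) : P = Measure.infinitePi fun _ => ν :=
  Measure.eq_infinitePi _ fun s t ht => hP.2 s t ht

/-- The sequence that follows `p.1` at indices `< B` and the translate of `p.2` by `B` from
index `B` on. -/
def glue (B : ℕ) (p : (ℤ → Ω) × (ℤ → Ω)) : ℤ → Ω :=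
  fun k => if k < B then p.1 k else p.2 (k - B)

theorem measurable_glue (B : ℕ) : Measurable (glue (Ω := Ω) B) := by
  refine measurable_pi_lambda _ fun k => ?_
  by_cases hk : k < (B : ℤ)
  · simp only [glue, hk, if_true]; fun_prop
  · simp only [glue, hk, if_false]; fun_prop

theorem IsBernoulli.glue {ν : Measure Ω} {P : Measure (ℤ → Ω)} (hP : IsBernoulli ν P) (B : ℕ) :
    IsBernoulli ν ((P.prod P).map (glue B)) := by
  have := hP.1
  refine ⟨Measure.isProbabilityMeasure_map (measurable_glue B).aemeasurable, fun s E hE => ?_⟩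
  have hm : MeasurableSet {ω : ℤ → Ω | ∀ i ∈ s, ω i ∈ E i} := by
    have : {ω : ℤ → Ω | ∀ i ∈ s, ω i ∈ E i} = ⋂ i ∈ s, (fun ω => ω i) ⁻¹' E i := by
      ext; simp
    rw [this]
    exact Finset.measurableSet_biInter _ fun i _ => measurable_pi_apply i (hE i)
  rw [Measure.map_apply (measurable_glue B) hm]
  have hset : _root_.glue B ⁻¹' {ω : ℤ → Ω | ∀ i ∈ s, ω i ∈ E i} =
      {ω : ℤ → Ω | ∀ i ∈ s.filter (· < (B : ℤ)), ω i ∈ E i} ×ˢ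
      {ω : ℤ → Ω | ∀ i ∈ (s.filter (¬ · < (B : ℤ))).map (Equiv.subRight (B : ℤ)).toEmbedding,
        ω i ∈ E (i + B)} := by
    ext ⟨ω, ω'⟩
    simp only [Set.mem_preimage, Set.mem_ofPred_eq, Set.mem_prod, _root_.glue, Finset.mem_filter,
      Finset.mem_map, Equiv.coe_toEmbedding, Equiv.subRight_apply]
    constructor
    · intro h
      refine ⟨fun i hi => by simpa [hi.2] using h i hi.1, ?_⟩
      rintro _ ⟨i, hi, rfl⟩
      simpa [hi.2] using h i hi.1
    · rintro ⟨h1, h2⟩ i hi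
      by_cases hB : i < (B : ℤ)
      · simpa [hB] using h1 i ⟨hi, hB⟩
      · simpa [hB] using h2 (i - B) ⟨i, ⟨hi, hB⟩, rfl⟩
  rw [hset, Measure.prod_prod, hP.2 _ _ hE, hP.2 _ _ fun i => hE (i + B), Finset.prod_map]
  simp only [Equiv.coe_toEmbedding, Equiv.subRight_apply, sub_add_cancel]
  exact Finset.prod_filter_mul_prod_filter_not s _ _

theorem IsBernoulli.map_glue {ν : Measure Ω} [IsProbabilityMeasure ν] {P : Measure (ℤ → Ω)}
    (hP : IsBernoulli ν P) (B : ℕ) : (P.prod P).map (_root_.glue B) = P := by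
  rw [(hP.glue B).eq_infinitePi, ← hP.eq_infinitePi]

/-- The first `n` coordinates of a Bernoulli sequence have the product law. -/
theorem IsBernoulli.map_fin {ν : Measure Ω} [IsProbabilityMeasure ν] {P : Measure (ℤ → Ω)}
    (hP : IsBernoulli ν P) (n : ℕ) :
    P.map (fun ω (i : Fin n) => ω ((i : ℕ) : ℤ)) = Measure.pi fun _ => ν := by
  refine (Measure.pi_eq fun s hs => ?_).symm
  have hmeas : Measurable fun (ω : ℤ → Ω) (i : Fin n) => ω ((i : ℕ) : ℤ) := by fun_prop
  rw [Measure.map_apply hmeas (MeasurableSet.univ_pi hs)]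
  classical
  obtain ⟨e, he⟩ : ∃ e : Fin n ↪ ℤ, ∀ i, e i = ((i : ℕ) : ℤ) :=
    ⟨⟨fun i => ((i : ℕ) : ℤ), fun i j h => by simpa [Fin.ext_iff] using h⟩, fun _ => rfl⟩
  obtain ⟨E, hE, hEs⟩ : ∃ E : ℤ → Set Ω, (∀ k, MeasurableSet (E k)) ∧
      ∀ i : Fin n, E ((i : ℕ) : ℤ) = s i := by
    refine ⟨fun k => if h : 0 ≤ k ∧ k.toNat < n then s ⟨k.toNat, h.2⟩ else Set.univ,
      fun k => ?_, fun i => by simp⟩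
    by_cases h : 0 ≤ k ∧ k.toNat < n
    · simpa only [h, and_self, dite_true] using hs _
    · simp only [h, dite_false, MeasurableSet.univ]
  have h := hP.2 (Finset.univ.map e) E hE
  rw [Finset.prod_map] at h
  simp only [Finset.mem_map, Finset.mem_univ, true_and, forall_exists_index,
    forall_apply_eq_imp_iff, he, hEs] at h
  rw [← h]
  congr 1
  ext ω
  simp [Set.mem_pi]

theorem IsBernoulli.map_zero {ν : Measure Ω} [IsProbabilityMeasure ν] {P : Measure (ℤ → Ω)}
    (hP : IsBernoulli ν P) : P.map (fun ω => ω 0) = ν := by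
  ext s hs
  rw [Measure.map_apply (measurable_pi_apply 0) hs]
  have h := hP.2 {0} (fun _ => s) fun _ => hs
  simp only [Finset.mem_singleton, forall_eq, Finset.prod_singleton] at h
  exact h

end Bernoulli

section SkewProduct

variable {Ω : Type*} {d : ℕ}

/-- The skew product `(ω, θ) ↦ (σω, θ + 𝔞(ω₀))`. -/
def skew (𝔞 : Ω → Td d) : ((ℤ → Ω) × Td d) → ((ℤ → Ω) × Td d) :=
  fun p => (shiftZ Ω p.1, p.2 + 𝔞 (p.1 0))

/-- The displacement `𝔞(ω₀) + ⋯ + 𝔞(ω_{n-1})` of the fibre coordinate after `n` steps. -/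
def cocycle (𝔞 : Ω → Td d) (n : ℕ) (ω : ℤ → Ω) : Td d := ∑ i ∈ Finset.range n, 𝔞 (ω i)

theorem skew_iterate (𝔞 : Ω → Td d) (n : ℕ) (ω : ℤ → Ω) (θ : Td d) :
    (skew 𝔞)^[n] (ω, θ) = (fun k => ω (k + n), θ + cocycle 𝔞 n ω) := by
  induction n with
  | zero => simp [cocycle]
  | succ n ih =>
    rw [Function.iterate_succ_apply', ih]
    refine Prod.ext ?_ ?_
    · ext k
      simp only [skew, shiftZ]
      congr 1; push_cast; ring
    · simp [skew, cocycle, Finset.sum_range_succ, add_assoc]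

/-- `χ (ω, θ)` depends only on `θ` and the coordinates `ω₀, …, ω_{L-1}`. -/
def DependsOnFirst (L : ℕ) (χ : ((ℤ → Ω) × Td d) → ℝ) : Prop :=
  ∀ (ω ω' : ℤ → Ω) (θ : Td d), (∀ i : ℕ, i < L → ω i = ω' i) → χ (ω, θ) = χ (ω', θ)

theorem cocycle_congr {𝔞 : Ω → Td d} {n : ℕ} {ω ω' : ℤ → Ω} (h : ∀ i : ℕ, i < n → ω i = ω' i) :
    cocycle 𝔞 n ω = cocycle 𝔞 n ω' :=
  Finset.sum_congr rfl fun i hi => by rw [h i (Finset.mem_range.1 hi)]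

theorem DependsOnFirst.iterate {L : ℕ} {χ : ((ℤ → Ω) × Td d) → ℝ} (h : DependsOnFirst L χ)
    (𝔞 : Ω → Td d) (n : ℕ) : DependsOnFirst (n + L) (fun p => χ ((skew 𝔞)^[n] p)) := by
  intro ω ω' θ hω
  simp only [skew_iterate]
  rw [cocycle_congr fun i hi => hω i (by omega : i < n + L)]
  refine h _ _ _ fun i hi => ?_
  simpa [add_comm] using hω (n + i) (by omega)

theorem DependsOnFirst.birkhoffSum {L : ℕ} {χ : ((ℤ → Ω) × Td d) → ℝ} (h : DependsOnFirst L χ)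
    (𝔞 : Ω → Td d) (n : ℕ) : DependsOnFirst (n + L) (birkhoffSum (skew 𝔞) χ n) := by
  intro ω ω' θ hω
  refine Finset.sum_congr rfl fun j hj => ?_
  have := Finset.mem_range.1 hj
  exact h.iterate 𝔞 j ω ω' θ fun i hi => hω i (by omega)

theorem abs_birkhoffSum_le {α : Type*} {f : α → α} {χ : α → ℝ} {C : ℝ} (hC : ∀ p, |χ p| ≤ C)
    (n : ℕ) (p : α) : |birkhoffSum f χ n p| ≤ n * C := by
  refine (Finset.abs_sum_le_sum_abs _ _).trans ?_
  simpa using Finset.sum_le_card_nsmul (Finset.range n) (fun k => |χ (f^[k] p)|) C fun k _ => hC _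

theorem continuous_skew [TopologicalSpace Ω] {𝔞 : Ω → Td d} (h𝔞 : Continuous 𝔞) :
    Continuous (skew 𝔞) := by
  unfold skew shiftZ; fun_prop

theorem continuous_birkhoffSum_skew [TopologicalSpace Ω] {𝔞 : Ω → Td d} (h𝔞 : Continuous 𝔞)
    {χ : ((ℤ → Ω) × Td d) → ℝ} (hχ : Continuous χ) (n : ℕ) :
    Continuous (birkhoffSum (skew 𝔞) χ n) :=
  continuous_finsetSum _ fun k _ => hχ.comp ((continuous_skew h𝔞).iterate k)

theorem continuous_cocycle [TopologicalSpace Ω] {𝔞 : Ω → Td d} (h𝔞 : Continuous 𝔞) (n : ℕ) :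
    Continuous (cocycle 𝔞 n) :=
  continuous_finsetSum _ fun _ _ => h𝔞.comp (continuous_apply _)

theorem glue_apply_natCast {B i : ℕ} (h : i < B) (p : (ℤ → Ω) × (ℤ → Ω)) :
    glue B p i = p.1 i := by
  simp [glue, h]

theorem cocycle_glue (𝔞 : Ω → Td d) (B : ℕ) (p : (ℤ → Ω) × (ℤ → Ω)) :
    cocycle 𝔞 B (glue B p) = cocycle 𝔞 B p.1 :=
  cocycle_congr fun _ hi => glue_apply_natCast hi p

theorem DependsOnFirst.apply_glue {L B : ℕ} {χ : ((ℤ → Ω) × Td d) → ℝ}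
    (h : DependsOnFirst L χ) (hLB : L ≤ B) (p : (ℤ → Ω) × (ℤ → Ω)) (θ : Td d) :
    χ (glue B p, θ) = χ (p.1, θ) :=
  h _ _ _ fun _ hi => glue_apply_natCast (hi.trans_le hLB) p

theorem DependsOnFirst.apply_iterate_glue {L : ℕ} {χ : ((ℤ → Ω) × Td d) → ℝ}
    (h : DependsOnFirst L χ) (𝔞 : Ω → Td d) (B : ℕ) (p : (ℤ → Ω) × (ℤ → Ω)) (θ : Td d) :
    χ ((skew 𝔞)^[B] (glue B p, θ)) = χ (p.2, θ + cocycle 𝔞 B p.1) := by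
  rw [skew_iterate, cocycle_glue]
  refine h _ _ _ fun i _ => ?_
  simp [glue]

end SkewProduct

section ExponentialMoments

/-- An exponential moment bound for a bounded random variable with mean at most `-1`. -/
theorem lintegral_exp_le_of_integral_le_neg_one {α : Type*} [MeasurableSpace α] {P : Measure α}
    [IsProbabilityMeasure P] {Y : α → ℝ} (hY : Measurable Y) {D : ℝ} (hD : 1 ≤ D)
    (hYD : ∀ a, |Y a| ≤ D) (hmean : ∫ a, Y a ∂P ≤ -1) :
    ∫⁻ a, ENNReal.ofReal (Real.exp (1 / (2 * D ^ 2) * Y a)) ∂P ≤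
      ENNReal.ofReal (Real.exp (-(1 / (2 * D ^ 2)) / 2)) := by
  set t : ℝ := 1 / (2 * D ^ 2) with ht
  have htpos : 0 < t := by positivity
  have htD2 : t * D ^ 2 = 1 / 2 := by rw [ht]; field_simp
  have htD : t * D ≤ 1 := by nlinarith
  have hpt : ∀ a, Real.exp (t * Y a) ≤ 1 + t * Y a + t / 2 := fun a => by
    have h1 : |t * Y a| ≤ t * D := by
      rw [abs_mul, abs_of_pos htpos]; exact mul_le_mul_of_nonneg_left (hYD a) htpos.le
    have h2 := (abs_le.1 (Real.abs_exp_sub_one_sub_id_le (h1.trans htD))).2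
    have h3 : (t * Y a) ^ 2 ≤ (t * D) ^ 2 := sq_le_sq' (by linarith [(abs_le.1 h1).1]) (abs_le.1 h1).2
    have h4 : (t * D) ^ 2 = t / 2 := by rw [mul_pow, pow_two t, mul_assoc, htD2]; ring
    linarith
  have hint : Integrable Y P := Integrable.of_bound hY.aestronglyMeasurable D (ae_of_all _ hYD)
  have hint2 : Integrable (fun a => 1 + t * Y a + t / 2) P :=
    ((integrable_const _).add (hint.const_mul t)).add (integrable_const _)
  calc ∫⁻ a, ENNReal.ofReal (Real.exp (t * Y a)) ∂P
      ≤ ∫⁻ a, ENNReal.ofReal (1 + t * Y a + t / 2) ∂P :=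
        lintegral_mono fun a => ENNReal.ofReal_le_ofReal (hpt a)
    _ = ENNReal.ofReal (∫ a, 1 + t * Y a + t / 2 ∂P) :=
        (ofReal_integral_eq_lintegral_ofReal hint2
          (ae_of_all _ fun a => (Real.exp_pos _).le.trans (hpt a))).symm
    _ ≤ _ := by
        refine ENNReal.ofReal_le_ofReal ?_
        rw [integral_add (by fun_prop) (by fun_prop), integral_add (by fun_prop) (by fun_prop),
          integral_const_mul]
        simp only [integral_const, probReal_univ, one_smul]
        have := Real.add_one_le_exp (-t / 2)
        nlinarith

variable {Ω : Type*} [MetricSpace Ω] [PolishSpace Ω] [MeasurableSpace Ω] [BorelSpace Ω] {d : ℕ}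
  {ν : Measure Ω} [IsProbabilityMeasure ν] {P : Measure (ℤ → Ω)} {𝔞 : Ω → Td d}
  {χ : ((ℤ → Ω) × Td d) → ℝ} {C : ℝ} {L : ℕ}

theorem lintegral_exp_birkhoffSum_add_le (hP : IsBernoulli ν P) (h𝔞 : Continuous 𝔞)
    (hχ : Continuous χ) (hχC : ∀ p, |χ p| ≤ C) (hχL : DependsOnFirst L χ) {t : ℝ} (ht : 0 ≤ t)
    {M n : ℕ} {ρ K : ENNReal}
    (hρ : ∀ θ, ∫⁻ ω, ENNReal.ofReal
      (Real.exp (t * (birkhoffSum (skew 𝔞) χ M (ω, θ) + L * C))) ∂P ≤ ρ)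
    (hK : ∀ θ, ∫⁻ ω, ENNReal.ofReal (Real.exp (t * birkhoffSum (skew 𝔞) χ n (ω, θ))) ∂P ≤ K)
    (θ : Td d) :
    ∫⁻ ω, ENNReal.ofReal (Real.exp (t * birkhoffSum (skew 𝔞) χ (M + L + n) (ω, θ))) ∂P ≤
      ρ * K := by
  have := hP.1
  have hS := fun n => continuous_birkhoffSum_skew h𝔞 hχ n
  have hc := continuous_cocycle h𝔞 (M + L)
  have hpt : ∀ p : (ℤ → Ω) × (ℤ → Ω),
      birkhoffSum (skew 𝔞) χ (M + L + n) (glue (M + L) p, θ) ≤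
        (birkhoffSum (skew 𝔞) χ M (p.1, θ) + L * C) +
          birkhoffSum (skew 𝔞) χ n (p.2, θ + cocycle 𝔞 (M + L) p.1) := fun p => by
    rw [birkhoffSum_add, birkhoffSum_add, (hχL.birkhoffSum 𝔞 M).apply_glue le_rfl,
      (hχL.birkhoffSum 𝔞 n).apply_iterate_glue 𝔞]
    gcongr
    exact (le_abs_self _).trans (abs_birkhoffSum_le hχC L _)
  have hmeas : Measurable fun ω : ℤ → Ω =>
      ENNReal.ofReal (Real.exp (t * birkhoffSum (skew 𝔞) χ (M + L + n) (ω, θ))) := by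
    have : Continuous fun ω : ℤ → Ω =>
      Real.exp (t * birkhoffSum (skew 𝔞) χ (M + L + n) (ω, θ)) := by fun_prop
    exact this.measurable.ennreal_ofReal
  have hmeas1 : Measurable fun ω : ℤ → Ω =>
      ENNReal.ofReal (Real.exp (t * (birkhoffSum (skew 𝔞) χ M (ω, θ) + L * C))) := by
    have : Continuous fun ω : ℤ → Ω =>
      Real.exp (t * (birkhoffSum (skew 𝔞) χ M (ω, θ) + L * C)) := by fun_prop
    exact this.measurable.ennreal_ofReal
  have hmeas2 : Measurable fun p : (ℤ → Ω) × (ℤ → Ω) =>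
      ENNReal.ofReal (Real.exp (t * birkhoffSum (skew 𝔞) χ n
        (p.2, θ + cocycle 𝔞 (M + L) p.1))) := by
    have : Continuous fun p : (ℤ → Ω) × (ℤ → Ω) =>
      Real.exp (t * birkhoffSum (skew 𝔞) χ n (p.2, θ + cocycle 𝔞 (M + L) p.1)) := by fun_prop
    exact this.measurable.ennreal_ofReal
  rw [← hP.map_glue (M + L), lintegral_map hmeas (measurable_glue _)]
  calc ∫⁻ p, ENNReal.ofReal (Real.exp (t * birkhoffSum (skew 𝔞) χ (M + L + n)
          (glue (M + L) p, θ))) ∂(P.prod P)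
      ≤ ∫⁻ p : (ℤ → Ω) × (ℤ → Ω),
          ENNReal.ofReal (Real.exp (t * (birkhoffSum (skew 𝔞) χ M (p.1, θ) + L * C))) *
          ENNReal.ofReal (Real.exp (t * birkhoffSum (skew 𝔞) χ n
            (p.2, θ + cocycle 𝔞 (M + L) p.1))) ∂(P.prod P) := by
        refine lintegral_mono fun p => ?_
        rw [← ENNReal.ofReal_mul (Real.exp_pos _).le, ← Real.exp_add, ← mul_add]
        exact ENNReal.ofReal_le_ofReal
          (Real.exp_le_exp.2 (mul_le_mul_of_nonneg_left (hpt p) ht))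
    _ = ∫⁻ ω, ENNReal.ofReal (Real.exp (t * (birkhoffSum (skew 𝔞) χ M (ω, θ) + L * C))) *
          ∫⁻ ω', ENNReal.ofReal (Real.exp (t * birkhoffSum (skew 𝔞) χ n
            (ω', θ + cocycle 𝔞 (M + L) ω))) ∂P ∂P := by
        refine (lintegral_prod _ ((hmeas1.comp measurable_fst).mul hmeas2).aemeasurable).trans
          (lintegral_congr fun ω => ?_)
        exact lintegral_const_mul (ENNReal.ofReal (Real.exp
          (t * (birkhoffSum (skew 𝔞) χ M (ω, θ) + L * C))))
          (hmeas2.comp (measurable_prodMk_left (x := ω)))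
    _ ≤ ∫⁻ ω, ENNReal.ofReal (Real.exp (t * (birkhoffSum (skew 𝔞) χ M (ω, θ) + L * C))) * K ∂P :=
        lintegral_mono fun ω => mul_le_mul_right (hK _) _
    _ = _ * K := lintegral_mul_const _ hmeas1
    _ ≤ ρ * K := mul_le_mul_left (hρ θ) _

/-- Exponential decay of the upper tail of Birkhoff sums of an observable whose sums over `M`
steps have sufficiently negative mean, uniformly in the base point. -/
theorem measure_birkhoffSum_nonneg_le (hP : IsBernoulli ν P) (h𝔞 : Continuous 𝔞)
    (hχ : Continuous χ) (hχC : ∀ p, |χ p| ≤ C) (hχL : DependsOnFirst L χ) (hL : 0 < L) {M : ℕ}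
    (hM : ∀ θ, ∫ ω, birkhoffSum (skew 𝔞) χ M (ω, θ) ∂P ≤ -(L * C) - 1)
    {t : ℝ} (ht : t = 1 / (2 * ((M + L) * C + 1) ^ 2)) (θ : Td d) (n : ℕ) :
    P {ω | 0 ≤ birkhoffSum (skew 𝔞) χ n (ω, θ)} ≤
      ENNReal.ofReal (Real.exp (t * ((M + L) * C) + t / 2 - t / (2 * (M + L)) * n)) := by
  have := hP.1
  have hS := fun n => continuous_birkhoffSum_skew h𝔞 hχ n
  obtain ⟨ω₀⟩ : Nonempty (ℤ → Ω) := nonempty_of_isProbabilityMeasure P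
  have hC : 0 ≤ C := (abs_nonneg _).trans (hχC (ω₀, 0))
  have htpos : 0 < t := by rw [ht]; positivity
  have hblock : ∀ θ, ∫⁻ ω, ENNReal.ofReal
      (Real.exp (t * (birkhoffSum (skew 𝔞) χ M (ω, θ) + L * C))) ∂P ≤
        ENNReal.ofReal (Real.exp (-t / 2)) := fun θ => by
    have hcont : Continuous fun ω : ℤ → Ω => birkhoffSum (skew 𝔞) χ M (ω, θ) := by fun_prop
    have hbd := fun ω : ℤ → Ω => abs_birkhoffSum_le (f := skew 𝔞) hχC M (ω, θ)
    have hint : Integrable (fun ω : ℤ → Ω => birkhoffSum (skew 𝔞) χ M (ω, θ)) P :=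
      Integrable.of_bound hcont.measurable.aestronglyMeasurable _ (ae_of_all _ hbd)
    rw [ht]
    refine lintegral_exp_le_of_integral_le_neg_one
      (Y := fun ω => birkhoffSum (skew 𝔞) χ M (ω, θ) + L * C)
      (hcont.add continuous_const).measurable (le_add_of_nonneg_left (by positivity)) (fun ω => ?_) ?_
    · have hLC : 0 ≤ L * C := by positivity
      have := abs_le.1 (hbd ω)
      rw [abs_le]
      constructor <;> linarith
    · rw [integral_add hint (integrable_const _)]
      simpa using (by linarith [hM θ] : ∫ ω, birkhoffSum (skew 𝔞) χ M (ω, θ) ∂P + L * C ≤ -1)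
  have hmoment : ∀ q r : ℕ, r ≤ M + L → ∀ θ, ∫⁻ ω, ENNReal.ofReal
      (Real.exp (t * birkhoffSum (skew 𝔞) χ ((M + L) * q + r) (ω, θ))) ∂P ≤
        ENNReal.ofReal (Real.exp (t * ((M + L) * C) - q * (t / 2))) := by
    intro q r hr
    induction q with
    | zero =>
      intro θ
      have hr' : (r : ℝ) ≤ M + L := by exact_mod_cast hr
      refine (lintegral_mono (g := fun _ => ENNReal.ofReal (Real.exp (t * ((M + L) * C))))
        fun ω => ?_).trans (by simp)
      refine ENNReal.ofReal_le_ofReal (Real.exp_le_exp.2 (mul_le_mul_of_nonneg_left ?_ htpos.le))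
      refine (le_abs_self _).trans ((abs_birkhoffSum_le hχC _ _).trans ?_)
      simpa using mul_le_mul_of_nonneg_right hr' hC
    | succ q ih =>
      intro θ
      have h := lintegral_exp_birkhoffSum_add_le hP h𝔞 hχ hχC hχL htpos.le hblock ih θ
      rw [← ENNReal.ofReal_mul (Real.exp_pos _).le, ← Real.exp_add] at h
      have e1 : M + L + ((M + L) * q + r) = (M + L) * (q + 1) + r := by ring
      have e2 : -t / 2 + (t * ((M + L) * C) - q * (t / 2)) =
          t * ((M + L) * C) - ((q + 1 : ℕ) : ℝ) * (t / 2) := by push_cast; ring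
      rwa [e1, e2] at h
  have hB : 0 < M + L := by omega
  have hBR : (0 : ℝ) < M + L := by exact_mod_cast hB
  have hn := hmoment (n / (M + L)) (n % (M + L)) (Nat.mod_lt _ hB).le θ
  rw [Nat.div_add_mod] at hn
  have hsub : {ω | 0 ≤ birkhoffSum (skew 𝔞) χ n (ω, θ)} ⊆
      {ω | 1 ≤ ENNReal.ofReal (Real.exp (t * birkhoffSum (skew 𝔞) χ n (ω, θ)))} := by
    intro ω hω
    have : (0 : ℝ) ≤ birkhoffSum (skew 𝔞) χ n (ω, θ) := hω
    change (1 : ENNReal) ≤ _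
    rw [ENNReal.one_le_ofReal]
    exact Real.one_le_exp (by positivity)
  have hmeas : Measurable fun ω : ℤ → Ω =>
      ENNReal.ofReal (Real.exp (t * birkhoffSum (skew 𝔞) χ n (ω, θ))) := by
    have : Continuous fun ω : ℤ → Ω =>
      Real.exp (t * birkhoffSum (skew 𝔞) χ n (ω, θ)) := by fun_prop
    exact this.measurable.ennreal_ofReal
  refine (measure_mono hsub).trans (le_trans ?_ (hn.trans ?_))
  · simpa using mul_meas_ge_le_lintegral (μ := P) hmeas 1
  · refine ENNReal.ofReal_le_ofReal (Real.exp_le_exp.2 ?_)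
    have hq : (n : ℝ) ≤ (M + L) * (((n / (M + L) : ℕ) : ℝ) + 1) := by
      exact_mod_cast (Nat.lt_mul_div_succ n hB).le
    have : t / (2 * (M + L)) * n ≤ t / 2 * (((n / (M + L) : ℕ) : ℝ) + 1) :=
      calc t / (2 * (M + L)) * n
          ≤ t / (2 * (M + L)) * ((M + L) * (((n / (M + L) : ℕ) : ℝ) + 1)) := by gcongr
        _ = _ := by field_simp
    linarith

end ExponentialMoments

section Wasserstein

theorem exists_ae_dist_le_of_isCompact {α : Type*} [MetricSpace α] [MeasurableSpace α]
    {μ : Measure α} (hμ : ∃ K : Set α, IsCompact K ∧ μ Kᶜ = 0) (x : α) :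
    ∃ R, ∀ᵐ y ∂μ, dist y x ≤ R := by
  obtain ⟨K, hK, hK0⟩ := hμ
  obtain ⟨R, hR⟩ := hK.isBounded.subset_closedBall x
  refine ⟨R, ?_⟩
  filter_upwards [mem_ae_iff.2 hK0] with y hy using hR hy

variable {Ω : Type*} [MetricSpace Ω] [MeasurableSpace Ω] [BorelSpace Ω]
  {ν ν' : Measure Ω} [IsProbabilityMeasure ν] [IsProbabilityMeasure ν']

theorem bddAbove_W1 (hν : ∃ K : Set Ω, IsCompact K ∧ ν Kᶜ = 0)
    (hν' : ∃ K : Set Ω, IsCompact K ∧ ν' Kᶜ = 0) :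
    BddAbove {r | ∃ g : Ω → ℝ, LipschitzWith 1 g ∧ r = (∫ x, g x ∂ν) - ∫ x, g x ∂ν'} := by
  obtain ⟨x⟩ : Nonempty Ω := nonempty_of_isProbabilityMeasure ν
  obtain ⟨R, hR⟩ := exists_ae_dist_le_of_isCompact hν x
  obtain ⟨R', hR'⟩ := exists_ae_dist_le_of_isCompact hν' x
  refine ⟨R + R', ?_⟩
  rintro _ ⟨g, hg, rfl⟩
  have key : ∀ (μ : Measure Ω) [IsProbabilityMeasure μ] (S : ℝ), (∀ᵐ y ∂μ, dist y x ≤ S) →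
      |∫ y, g y ∂μ - g x| ≤ S := fun μ _ S hS => by
    have hb : ∀ᵐ y ∂μ, ‖g y - g x‖ ≤ S := by
      filter_upwards [hS] with y hy
      rw [← dist_eq_norm]
      exact (hg.dist_le_mul y x).trans (by simpa using hy)
    have hi : Integrable (fun y => g y - g x) μ :=
      Integrable.of_bound (hg.continuous.sub continuous_const).measurable.aestronglyMeasurable S hb
    have hg' : Integrable g μ :=
      (hi.add (integrable_const (g x))).congr (ae_of_all _ fun y => sub_add_cancel _ _)
    have := norm_integral_le_of_norm_le_const hb
    rw [integral_sub hg' (integrable_const _)] at this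
    simpa using this
  have h1 := abs_le.1 (key ν R hR)
  have h2 := abs_le.1 (key ν' R' hR')
  linarith

theorem integral_sub_integral_le_mul_W1 (hν : ∃ K : Set Ω, IsCompact K ∧ ν Kᶜ = 0)
    (hν' : ∃ K : Set Ω, IsCompact K ∧ ν' Kᶜ = 0) {κ : NNReal} (hκ : 0 < κ) {g : Ω → ℝ}
    (hg : LipschitzWith κ g) : ∫ x, g x ∂ν - ∫ x, g x ∂ν' ≤ κ * W1 ν ν' := by
  have hg1 : LipschitzWith 1 fun x => (κ : ℝ)⁻¹ * g x := by
    refine LipschitzWith.of_dist_le_mul fun x y => ?_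
    have := hg.dist_le_mul x y
    rw [Real.dist_eq, ← mul_sub, abs_mul, abs_of_nonneg (by positivity), ← Real.dist_eq,
      NNReal.coe_one, one_mul, inv_mul_le_iff₀ (by exact_mod_cast hκ)]
    exact this
  have := le_csSup (bddAbove_W1 hν hν') ⟨_, hg1, rfl⟩
  rw [integral_const_mul, integral_const_mul, ← mul_sub,
    inv_mul_le_iff₀ (by exact_mod_cast hκ)] at this
  exact this

variable [PolishSpace Ω]

theorem integral_pi_fin_succ (μ : Measure Ω) [IsProbabilityMeasure μ] {n : ℕ}
    {h : (Fin (n + 1) → Ω) → ℝ} (hh : Continuous h) {C : ℝ} (hC : ∀ x, |h x| ≤ C) :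
    ∫ x, h x ∂(Measure.pi fun _ => μ) =
      ∫ a, ∫ x, h (Fin.cons a x) ∂(Measure.pi fun _ : Fin n => μ) ∂μ := by
  have hmp := (measurePreserving_piFinSuccAbove (fun _ : Fin (n + 1) => μ) 0).symm
  rw [← hmp.integral_comp' h]
  have hcons : Continuous fun p : Ω × (Fin n → Ω) => h (Fin.cons p.1 p.2) :=
    hh.comp (Continuous.finCons (A := fun _ => Ω) continuous_fst continuous_snd)
  have hint : Integrable (fun p : Ω × (Fin n → Ω) => h (Fin.cons p.1 p.2))
      (μ.prod (Measure.pi fun _ : Fin n => μ)) :=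
    Integrable.of_bound hcons.measurable.aestronglyMeasurable C (ae_of_all _ fun _ => hC _)
  rw [← integral_prod _ hint]
  simp only [MeasurableEquiv.piFinSuccAbove_symm_apply, Fin.insertNthEquiv, Equiv.coe_fn_mk,
    Fin.insertNth_zero']

theorem LipschitzWith.integral_finCons {μ : Measure Ω} [IsProbabilityMeasure μ] {n : ℕ}
    {κ : NNReal} {h : (Fin (n + 1) → Ω) → ℝ} (hh : LipschitzWith κ h) {C : ℝ}
    (hC : ∀ x, |h x| ≤ C) :
    LipschitzWith κ fun a => ∫ x, h (Fin.cons a x) ∂(Measure.pi fun _ : Fin n => μ) := by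
  have hint : ∀ a, Integrable (fun x : Fin n → Ω => h (Fin.cons a x))
      (Measure.pi fun _ => μ) := fun a =>
    Integrable.of_bound (hh.continuous.comp
      (Continuous.finCons (A := fun _ => Ω) continuous_const continuous_id)).measurable.aestronglyMeasurable C
      (ae_of_all _ fun _ => hC _)
  refine LipschitzWith.of_dist_le_mul fun a b => ?_
  rw [dist_eq_norm, ← integral_sub (hint a) (hint b)]
  refine (norm_integral_le_of_norm_le_const (C := κ * dist a b) (ae_of_all _ fun x => ?_)).trans
    (by simp)
  rw [← dist_eq_norm]
  refine (hh.dist_le_mul _ _).trans (mul_le_mul_of_nonneg_left ?_ κ.2)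
  refine (dist_pi_le_iff dist_nonneg).2 fun i => ?_
  refine Fin.cases ?_ (fun j => ?_) i <;> simp

theorem integral_pi_sub_integral_pi_le (hν : ∃ K : Set Ω, IsCompact K ∧ ν Kᶜ = 0)
    (hν' : ∃ K : Set Ω, IsCompact K ∧ ν' Kᶜ = 0) {κ : NNReal} (hκ : 0 < κ) {C : ℝ} (n : ℕ)
    {h : (Fin n → Ω) → ℝ} (hh : LipschitzWith κ h) (hC : ∀ x, |h x| ≤ C) :
    ∫ x, h x ∂(Measure.pi fun _ => ν) - ∫ x, h x ∂(Measure.pi fun _ => ν') ≤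
      n * (κ * W1 ν ν') := by
  induction n with
  | zero => rw [Measure.pi_of_empty, Measure.pi_of_empty]; simp
  | succ n ih =>
    have hbd : ∀ (μ : Measure Ω) [IsProbabilityMeasure μ] (a : Ω),
        |∫ x, h (Fin.cons a x) ∂(Measure.pi fun _ : Fin n => μ)| ≤ C := fun μ _ a => by
      simpa using norm_integral_le_of_norm_le_const (μ := Measure.pi fun _ : Fin n => μ)
        (f := fun x => h (Fin.cons a x))
        (ae_of_all _ fun x => hC _)
    have hint : ∀ (μ μ' : Measure Ω) [IsProbabilityMeasure μ] [IsProbabilityMeasure μ'],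
        Integrable (fun a => ∫ x, h (Fin.cons a x) ∂(Measure.pi fun _ : Fin n => μ)) μ' :=
      fun μ μ' _ _ => Integrable.of_bound
        (hh.integral_finCons hC).continuous.measurable.aestronglyMeasurable C
        (ae_of_all _ (hbd μ))
    have h1 : ∫ a, ∫ x, h (Fin.cons a x) ∂(Measure.pi fun _ : Fin n => ν) ∂ν -
        ∫ a, ∫ x, h (Fin.cons a x) ∂(Measure.pi fun _ : Fin n => ν') ∂ν ≤
          n * (κ * W1 ν ν') := by
      rw [← integral_sub (hint ν ν) (hint ν' ν)]
      refine (integral_mono ((hint ν ν).sub (hint ν' ν)) (integrable_const (n * (κ * W1 ν ν')))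
        fun a => ?_).trans (by simp)
      refine ih (h := fun x => h (Fin.cons a x)) (LipschitzWith.of_dist_le_mul fun x y => ?_)
        fun x => hC _
      refine (hh.dist_le_mul _ _).trans (mul_le_mul_of_nonneg_left ?_ κ.2)
      refine (dist_pi_le_iff dist_nonneg).2 fun i => ?_
      refine Fin.cases ?_ (fun j => ?_) i
      · simp
      · simpa using dist_le_pi_dist x y j
    have h2 := integral_sub_integral_le_mul_W1 hν hν' hκ (hh.integral_finCons (μ := ν') hC)
    rw [integral_pi_fin_succ ν hh.continuous hC, integral_pi_fin_succ ν' hh.continuous hC]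
    push_cast
    linarith

/-- The largest `κ`-Lipschitz minorant (Pasch–Hausdorff envelope) of a function. -/
def lipschitzEnvelope {α : Type*} [PseudoMetricSpace α] (κ : NNReal) (u : α → ℝ) (x : α) : ℝ :=
  ⨅ y, u y + κ * dist x y

section LipschitzEnvelope

variable {α : Type*} [PseudoMetricSpace α] {κ : NNReal} {u : α → ℝ} {C : ℝ}

theorem bddBelow_lipschitzEnvelope (hC : ∀ x, |u x| ≤ C) (x : α) :
    BddBelow (Set.range fun y => u y + κ * dist x y) := by
  refine ⟨-C, ?_⟩
  rintro _ ⟨y, rfl⟩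
  have := (abs_le.1 (hC y)).1
  have : 0 ≤ κ * dist x y := by positivity
  dsimp only
  linarith

theorem lipschitzEnvelope_le (hC : ∀ x, |u x| ≤ C) (x : α) : lipschitzEnvelope κ u x ≤ u x := by
  exact (ciInf_le (bddBelow_lipschitzEnvelope (κ := κ) hC x) x).trans (by simp)

theorem lipschitzWith_lipschitzEnvelope (hC : ∀ x, |u x| ≤ C) :
    LipschitzWith κ (lipschitzEnvelope κ u) := by
  refine LipschitzWith.of_le_add_mul κ fun x y => ?_
  have : Nonempty α := ⟨x⟩
  rw [← sub_le_iff_le_add]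
  refine le_ciInf fun z => ?_
  have h1 := ciInf_le (bddBelow_lipschitzEnvelope (κ := κ) hC x) z
  have h2 := mul_le_mul_of_nonneg_left (dist_triangle x y z) κ.2
  have h3 : lipschitzEnvelope κ u x ≤ u z + κ * dist x z := h1
  rw [mul_add] at h2
  change κ * dist x z ≤ κ * dist x y + κ * dist y z at h2
  linarith

theorem abs_lipschitzEnvelope_le (hC : ∀ x, |u x| ≤ C) (x : α) :
    |lipschitzEnvelope κ u x| ≤ C := by
  have : Nonempty α := ⟨x⟩
  refine abs_le.2 ⟨le_ciInf fun y => ?_, (lipschitzEnvelope_le hC x).trans (abs_le.1 (hC x)).2⟩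
  have := (abs_le.1 (hC y)).1
  have : 0 ≤ κ * dist x y := by positivity
  linarith

theorem le_lipschitzEnvelope_add (hC : ∀ x, |u x| ≤ C) {x : α} {r η : ℝ}
    (hη : 0 ≤ η) (hr : ∀ y, dist x y < r → u x ≤ u y + η) (hκ : 2 * C ≤ κ * r) :
    u x ≤ lipschitzEnvelope κ u x + η := by
  have : Nonempty α := ⟨x⟩
  rw [← sub_le_iff_le_add]
  refine le_ciInf fun y => ?_
  have h0 : 0 ≤ κ * dist x y := by positivity
  rcases lt_or_ge (dist x y) r with h | h
  · linarith [hr y h]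
  · have h1 : κ * r ≤ κ * dist x y := mul_le_mul_of_nonneg_left h κ.2
    linarith [(abs_le.1 (hC y)).1, (abs_le.1 (hC x)).2]

end LipschitzEnvelope

/-- Lower semicontinuity in `W₁` at `ν₀` of product expectations of a continuous bounded function,
uniformly in a parameter ranging over a compact space. -/
theorem exists_forall_integral_pi_le {Θ : Type*} [MetricSpace Θ] [CompactSpace Θ]
    (ν₀ : Measure Ω) [IsProbabilityMeasure ν₀] (hν₀ : ∃ K : Set Ω, IsCompact K ∧ ν₀ Kᶜ = 0)
    {n : ℕ} {u : (Fin n → Ω) × Θ → ℝ} (hu : Continuous u) {C : ℝ} (hC : ∀ p, |u p| ≤ C)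
    {η : ℝ} (hη : 0 < η) :
    ∃ δ > (0 : ℝ), ∀ (ν : Measure Ω) [IsProbabilityMeasure ν],
      (∃ K : Set Ω, IsCompact K ∧ ν Kᶜ = 0) → W1 ν ν₀ < δ → ∀ θ,
        ∫ x, u (x, θ) ∂(Measure.pi fun _ => ν) ≤ ∫ x, u (x, θ) ∂(Measure.pi fun _ => ν₀) + η := by
  obtain ⟨K, hK, hK0⟩ := hν₀
  have hKn : IsCompact ((Set.univ.pi fun _ : Fin n => K) ×ˢ (Set.univ : Set Θ)) :=
    (isCompact_univ_pi fun _ => hK).prod isCompact_univ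
  have hae : ∀ᵐ x ∂(Measure.pi fun _ : Fin n => ν₀), x ∈ Set.univ.pi fun _ : Fin n => K := by
    have : ∀ i : Fin n, ∀ᵐ x ∂(Measure.pi fun _ : Fin n => ν₀), x i ∈ K := fun i =>
      (measurePreserving_eval (fun _ : Fin n => ν₀) i).quasiMeasurePreserving.ae
        (mem_ae_iff.2 hK0)
    filter_upwards [ae_all_iff.2 this] with x hx i _ using hx i
  have hunif := hKn.uniformContinuousAt_of_continuousAt u (fun _ _ => hu.continuousAt)
    (Metric.dist_mem_uniformity (half_pos hη))
  obtain ⟨r, hr, hru⟩ := Metric.mem_uniformity_dist.1 hunif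
  obtain ⟨κ, hκ, hκr⟩ : ∃ κ : NNReal, 0 < κ ∧ 2 * C ≤ κ * r := by
    refine ⟨(2 * |C| / r + 1).toNNReal, by simp; positivity, ?_⟩
    rw [Real.coe_toNNReal _ (by positivity), add_mul, div_mul_cancel₀ _ hr.ne']
    linarith [le_abs_self C]
  refine ⟨η / (2 * ((n + 1) * κ)), by positivity, fun ν _ hν hW θ => ?_⟩
  have hbd : ∀ x, |-u (x, θ)| ≤ C := fun x => by rw [abs_neg]; exact hC _
  set h := lipschitzEnvelope κ fun x => -u (x, θ) with hh
  have hcont : Continuous fun x => -u (x, θ) := by fun_prop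
  have hL : LipschitzWith κ h := lipschitzWith_lipschitzEnvelope hbd
  have hint : ∀ (μ : Measure Ω) [IsProbabilityMeasure μ],
      Integrable h (Measure.pi fun _ => μ) := fun μ _ =>
    Integrable.of_bound hL.continuous.measurable.aestronglyMeasurable C
      (ae_of_all _ (abs_lipschitzEnvelope_le hbd))
  have hintu : ∀ (μ : Measure Ω) [IsProbabilityMeasure μ],
      Integrable (fun x => -u (x, θ)) (Measure.pi fun _ => μ) := fun μ _ =>
    Integrable.of_bound hcont.measurable.aestronglyMeasurable C (ae_of_all _ hbd)
  have h1 : ∫ x, h x ∂(Measure.pi fun _ => ν) ≤ ∫ x, -u (x, θ) ∂(Measure.pi fun _ => ν) :=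
    integral_mono (hint ν) (hintu ν) fun x => lipschitzEnvelope_le hbd x
  have h2 : ∫ x, -u (x, θ) ∂(Measure.pi fun _ => ν₀) ≤
      ∫ x, h x ∂(Measure.pi fun _ => ν₀) + η / 2 := by
    have : ∫ x, -u (x, θ) ∂(Measure.pi fun _ => ν₀) ≤
        ∫ x, (h x + η / 2) ∂(Measure.pi fun _ => ν₀) := by
      refine integral_mono_ae (hintu ν₀) ((hint ν₀).add (integrable_const _)) ?_
      filter_upwards [hae] with x hx
      refine le_lipschitzEnvelope_add hbd (half_pos hη).le (fun y hy => ?_) hκr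
      have := @hru (x, θ) (y, θ) (by simpa [Prod.dist_eq, hr] using hy) ⟨hx, trivial⟩
      have := abs_lt.1 (Real.dist_eq _ _ ▸ this : |u (x, θ) - u (y, θ)| < η / 2)
      linarith
    rwa [integral_add (hint ν₀) (integrable_const _), integral_const, probReal_univ,
      one_smul] at this
  have h3 := integral_pi_sub_integral_pi_le hν ⟨K, hK, hK0⟩ hκ n (h := fun x => -h x) hL.neg
    (fun x => by rw [abs_neg]; exact abs_lipschitzEnvelope_le hbd x)
  have h4 : n * (κ * W1 ν ν₀) ≤ η / 2 :=
    calc n * (κ * W1 ν ν₀) ≤ (n + 1) * (κ * (η / (2 * ((n + 1) * κ)))) := by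
          have : n * (κ * W1 ν ν₀) ≤ n * (κ * (η / (2 * ((n + 1) * κ)))) := by gcongr
          refine this.trans ?_
          gcongr
          linarith
      _ = η / 2 := by field_simp
  simp only [integral_neg] at h1 h2 h3
  linarith

end Wasserstein

section BernoulliIntegrals

variable {Ω : Type*} [MetricSpace Ω] [PolishSpace Ω] [MeasurableSpace Ω] [BorelSpace Ω] {d : ℕ}

/-- Lower semicontinuity in `W₁` at `ν₀` of Bernoulli expectations of an observable depending on
finitely many coordinates, uniformly in the fibre variable. -/
theorem exists_forall_integral_bernoulli_le
    (ν₀ : Measure Ω) [IsProbabilityMeasure ν₀] (hν₀ : ∃ K : Set Ω, IsCompact K ∧ ν₀ Kᶜ = 0)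
    {P₀ : Measure (ℤ → Ω)} (hP₀ : IsBernoulli ν₀ P₀) {χ : ((ℤ → Ω) × Td d) → ℝ}
    (hχ : Continuous χ) {C : ℝ} (hC : ∀ p, |χ p| ≤ C) {L : ℕ} (hL : DependsOnFirst L χ)
    {η : ℝ} (hη : 0 < η) :
    ∃ δ > (0 : ℝ), ∀ (ν : Measure Ω) [IsProbabilityMeasure ν],
      (∃ K : Set Ω, IsCompact K ∧ ν Kᶜ = 0) → W1 ν ν₀ < δ →
        ∀ P : Measure (ℤ → Ω), IsBernoulli ν P → ∀ θ,
          ∫ ω, χ (ω, θ) ∂P ≤ ∫ ω, χ (ω, θ) ∂P₀ + η := by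
  obtain ⟨x₀⟩ : Nonempty Ω := nonempty_of_isProbabilityMeasure ν₀
  obtain ⟨ext, hext, hext'⟩ : ∃ ext : (Fin L → Ω) → ℤ → Ω, Continuous ext ∧
      ∀ x (i : Fin L), ext x ((i : ℕ) : ℤ) = x i := by
    refine ⟨fun x k => if h : 0 ≤ k ∧ k.toNat < L then x ⟨k.toNat, h.2⟩ else x₀,
      continuous_pi fun k => ?_, fun x i => by simp⟩
    by_cases h : 0 ≤ k ∧ k.toNat < L
    · simp only [h, and_self, dite_true]; fun_prop
    · simp only [h, dite_false]; fun_prop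
  have hcont : Continuous fun p : (Fin L → Ω) × Td d => χ (ext p.1, p.2) := by fun_prop
  have hrestr : ∀ (ν : Measure Ω) [IsProbabilityMeasure ν] (P : Measure (ℤ → Ω)),
      IsBernoulli ν P → ∀ θ, ∫ ω, χ (ω, θ) ∂P = ∫ x, χ (ext x, θ) ∂(Measure.pi fun _ => ν) := by
    intro ν _ P hP θ
    have hc : Continuous fun x : Fin L → Ω => χ (ext x, θ) := by fun_prop
    have hm : Measurable fun (ω : ℤ → Ω) (i : Fin L) => ω ((i : ℕ) : ℤ) := by fun_prop
    rw [← hP.map_fin L, integral_map hm.aemeasurable hc.measurable.aestronglyMeasurable]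
    refine integral_congr_ae (ae_of_all _ fun ω => hL _ _ _ fun i hi => ?_)
    exact (hext' (fun j : Fin L => ω ((j : ℕ) : ℤ)) ⟨i, hi⟩).symm
  obtain ⟨δ, hδ, h⟩ := exists_forall_integral_pi_le ν₀ hν₀ hcont (fun _ => hC _) hη
  refine ⟨δ, hδ, fun ν _ hν hW P hP θ => ?_⟩
  rw [hrestr ν P hP, hrestr ν₀ P₀ hP₀]
  exact h ν hν hW θ

variable {ν : Measure Ω} [IsProbabilityMeasure ν] {P : Measure (ℤ → Ω)} {𝔞 : Ω → Td d}

theorem IsBernoulli.integral_eq_integral_glue {E : Type*} [NormedAddCommGroup E] [NormedSpace ℝ E]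
    (hP : IsBernoulli ν P) (B : ℕ)
    {F : (ℤ → Ω) → E} (hF : Continuous F) {C : ℝ} (hC : ∀ ω, ‖F ω‖ ≤ C) :
    ∫ ω, F ω ∂P = ∫ ω, ∫ ω', F (_root_.glue B (ω, ω')) ∂P ∂P := by
  have := hP.1
  have hm : StronglyMeasurable F := hF.stronglyMeasurable
  conv_lhs => rw [← hP.map_glue B,
    integral_map (measurable_glue B).aemeasurable hm.aestronglyMeasurable]
  exact integral_prod _ (Integrable.of_bound
    (hm.comp_measurable (measurable_glue B)).aestronglyMeasurable C (ae_of_all _ fun _ => hC _))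

theorem mFourier_add_apply (k : Fin d → ℤ) (x y : Td d) :
    UnitAddTorus.mFourier k (x + y) = UnitAddTorus.mFourier k x * UnitAddTorus.mFourier k y := by
  simp [UnitAddTorus.mFourier, fourier_apply, smul_add, AddCircle.toCircle_add,
    Finset.prod_mul_distrib]

theorem norm_mFourier_apply (k : Fin d → ℤ) (x : Td d) : ‖UnitAddTorus.mFourier k x‖ = 1 := by
  simp only [UnitAddTorus.mFourier, ContinuousMap.coe_mk, fourier_apply, norm_prod,
    Circle.norm_coe, Finset.prod_const_one]

theorem integral_mFourier_eq_zero {k : Fin d → ℤ} (hk : k ≠ 0) :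
    ∫ x : Td d, UnitAddTorus.mFourier k x = 0 := by
  obtain ⟨i, hi⟩ := Function.ne_iff.1 hk
  let s : Td d := Pi.single i (((1 : ℝ) / 2 / k i : ℝ) : AddCircle (1 : ℝ))
  have hs : UnitAddTorus.mFourier k s = -1 := by
    have h1 : ∀ j ≠ i, fourier (k j) (s j) = (1 : ℂ) := fun j hj => by simp [s, hj]
    have h2 : fourier (k i) (s i) = (-1 : ℂ) := by
      have := fourier_add_half_inv_index (T := (1 : ℝ)) hi one_pos 0
      simpa [s] using this
    change ∏ j, fourier (k j) (s j) = (-1 : ℂ)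
    rw [Finset.prod_eq_single i (fun j _ hj => h1 j hj) (by simp), h2]
  have h := integral_add_right_eq_self (μ := (volume : Measure (Td d)))
    (fun x : Td d => UnitAddTorus.mFourier k x) s
  simp only [mFourier_add_apply, hs, mul_neg, mul_one, integral_neg] at h
  exact self_eq_neg.1 h.symm

theorem integral_mFourier_cocycle (hP : IsBernoulli ν P) (h𝔞 : Continuous 𝔞) (k : Fin d → ℤ)
    (n : ℕ) : ∫ ω, UnitAddTorus.mFourier k (cocycle 𝔞 n ω) ∂P =
      (∫ x, UnitAddTorus.mFourier k (𝔞 x) ∂ν) ^ n := by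
  have := hP.1
  induction n with
  | zero => simp [cocycle, UnitAddTorus.mFourier]
  | succ n ih =>
    have hc := continuous_cocycle h𝔞 (n + 1)
    rw [hP.integral_eq_integral_glue n (F := fun ω => UnitAddTorus.mFourier k (cocycle 𝔞 (n + 1) ω))
      (by fun_prop) (fun ω => (norm_mFourier_apply k _).le)]
    have hsplit : ∀ ω ω' : ℤ → Ω, cocycle 𝔞 (n + 1) (glue n (ω, ω')) =
        cocycle 𝔞 n ω + 𝔞 (ω' 0) := fun ω ω' => by
      rw [← cocycle_glue 𝔞 n (ω, ω'), cocycle, Finset.sum_range_succ, ← cocycle]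
      simp [glue]
    simp only [hsplit, mFourier_add_apply, integral_const_mul, integral_mul_const, ih, pow_succ]
    congr 1
    have hm : Continuous fun x : Ω => UnitAddTorus.mFourier k (𝔞 x) := by fun_prop
    conv_rhs => rw [← hP.map_zero, integral_map (measurable_pi_apply 0).aemeasurable
      hm.stronglyMeasurable.aestronglyMeasurable]

/-- Ergodicity of the skew product excludes resonances of `ν`. -/
theorem integral_mFourier_ne_one (hP : IsBernoulli ν P) (h𝔞 : Continuous 𝔞)
    (herg : Ergodic (skew 𝔞) (P.prod volume)) {k : Fin d → ℤ} (hk : k ≠ 0) :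
    ∫ x, UnitAddTorus.mFourier k (𝔞 x) ∂ν ≠ 1 := by
  intro h1
  have := hP.1
  have hm : Continuous fun x : Ω => UnitAddTorus.mFourier k (𝔞 x) := by fun_prop
  have hint : Integrable (fun x : Ω => UnitAddTorus.mFourier k (𝔞 x)) ν :=
    Integrable.of_bound hm.stronglyMeasurable.aestronglyMeasurable 1
      (ae_of_all _ fun x => (norm_mFourier_apply k _).le)
  have hae : ∀ᵐ x ∂ν, UnitAddTorus.mFourier k (𝔞 x) = 1 := by
    have hre : ∫ x, (1 - (UnitAddTorus.mFourier k (𝔞 x)).re) ∂ν = 0 := by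
      have h2 : ∫ x, (UnitAddTorus.mFourier k (𝔞 x)).re ∂ν = 1 := by
        have := integral_re hint
        simpa [h1] using this
      refine (integral_sub (integrable_const _) hint.re).trans ?_
      simp [h2]
    have hle : ∀ x, (UnitAddTorus.mFourier k (𝔞 x)).re ≤ 1 := fun x =>
      (Complex.re_le_norm _).trans (norm_mFourier_apply k _).le
    have := (integral_eq_zero_iff_of_nonneg (fun x => sub_nonneg.2 (hle x))
      ((integrable_const _).sub hint.re)).1 hre
    filter_upwards [this] with x hx
    have hx1 : (UnitAddTorus.mFourier k (𝔞 x)).re = 1 := by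
      have : 1 - (UnitAddTorus.mFourier k (𝔞 x)).re = 0 := hx
      linarith
    have hn := norm_mFourier_apply k (𝔞 x)
    have hsq := Complex.sq_norm (UnitAddTorus.mFourier k (𝔞 x))
    rw [hn, Complex.normSq_apply, hx1] at hsq
    exact Complex.ext hx1 (mul_self_eq_zero.1 (by linarith))
  have hinv : (fun p : (ℤ → Ω) × Td d => UnitAddTorus.mFourier k p.2) ∘ skew 𝔞 =ᵐ[P.prod volume]
      fun p => UnitAddTorus.mFourier k p.2 := by
    have h0 : ∀ᵐ ω ∂P, UnitAddTorus.mFourier k (𝔞 (ω 0)) = 1 :=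
      ae_of_ae_map (f := fun ω : ℤ → Ω => ω 0) (measurable_pi_apply 0).aemeasurable
        (by rwa [hP.map_zero])
    filter_upwards [Measure.quasiMeasurePreserving_fst.ae h0] with p hp
    simp [skew, mFourier_add_apply, hp]
  have hmeas : Continuous fun p : (ℤ → Ω) × Td d => UnitAddTorus.mFourier k p.2 := by fun_prop
  obtain ⟨c, hc⟩ := herg.ae_eq_const_of_ae_eq_comp_ae
    hmeas.stronglyMeasurable.aestronglyMeasurable hinv
  have hc1 : ∫ p, UnitAddTorus.mFourier k p.2 ∂(P.prod (volume : Measure (Td d))) = c := by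
    rw [integral_congr_ae hc]; simp
  rw [integral_fun_snd, integral_mFourier_eq_zero hk, smul_zero] at hc1
  obtain ⟨p, hp⟩ := hc.exists
  have := norm_mFourier_apply k p.2
  rw [show UnitAddTorus.mFourier k p.2 = c from hp] at this
  simp [← hc1] at this

end BernoulliIntegrals

section Equidistribution

variable {Ω : Type*} [MeasurableSpace Ω] {d : ℕ} {P : Measure (ℤ → Ω)} {𝔞 : Ω → Td d}

/-- The accumulated deviation from the mean of `g` along the random walk started at `θ`. -/
def walkDeviation (P : Measure (ℤ → Ω)) (𝔞 : Ω → Td d) (g : Td d → ℂ) (n : ℕ) (θ : Td d) : ℂ :=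
  ∑ j ∈ Finset.range n, (∫ ω, g (θ + cocycle 𝔞 j ω) ∂P - ∫ x, g x)

theorem integrable_torus (g : C(Td d, ℂ)) : Integrable g (volume : Measure (Td d)) :=
  Integrable.of_bound g.continuous.stronglyMeasurable.aestronglyMeasurable ‖g‖
    (ae_of_all _ fun _ => g.norm_coe_le_norm _)

theorem walkDeviation_smul (c : ℂ) (g : C(Td d, ℂ)) (n : ℕ) (θ : Td d) :
    walkDeviation P 𝔞 (c • g : C(Td d, ℂ)) n θ = c * walkDeviation P 𝔞 g n θ := by
  simp only [walkDeviation, Finset.mul_sum, ContinuousMap.smul_apply, smul_eq_mul,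
    integral_const_mul, mul_sub]

theorem norm_walkDeviation_le [IsProbabilityMeasure P] (g : C(Td d, ℂ)) (n : ℕ) (θ : Td d) :
    ‖walkDeviation P 𝔞 g n θ‖ ≤ n * (2 * ‖g‖) := by
  refine (norm_sum_le_of_le (f := fun j => ∫ ω, g (θ + cocycle 𝔞 j ω) ∂P - ∫ x, g x)
    (n := fun _ => 2 * ‖g‖) _ fun j _ => ?_).trans (by simp)
  have h1 := norm_integral_le_of_norm_le_const (μ := P) (C := ‖g‖)
    (f := fun ω => g (θ + cocycle 𝔞 j ω)) (ae_of_all _ fun _ => g.norm_coe_le_norm _)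
  have h2 := norm_integral_le_of_norm_le_const (μ := (volume : Measure (Td d))) (C := ‖g‖)
    (f := g) (ae_of_all _ fun _ => g.norm_coe_le_norm _)
  have h3 := norm_sub_le (∫ ω, g (θ + cocycle 𝔞 j ω) ∂P) (∫ x, g x)
  simp only [probReal_univ, mul_one] at h1 h2
  linarith

variable [MetricSpace Ω] [PolishSpace Ω] [BorelSpace Ω]

theorem integrable_comp_cocycle [IsProbabilityMeasure P] (h𝔞 : Continuous 𝔞) (g : C(Td d, ℂ))
    (j : ℕ) (θ : Td d) : Integrable (fun ω => g (θ + cocycle 𝔞 j ω)) P := by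
  have hc := continuous_cocycle h𝔞 j
  have : Continuous fun ω => g (θ + cocycle 𝔞 j ω) := by fun_prop
  exact Integrable.of_bound this.stronglyMeasurable.aestronglyMeasurable ‖g‖
    (ae_of_all _ fun _ => g.norm_coe_le_norm _)

theorem walkDeviation_add [IsProbabilityMeasure P] (h𝔞 : Continuous 𝔞) (g h : C(Td d, ℂ)) (n : ℕ)
    (θ : Td d) : walkDeviation P 𝔞 (g + h : C(Td d, ℂ)) n θ =
      walkDeviation P 𝔞 g n θ + walkDeviation P 𝔞 h n θ := by
  simp only [walkDeviation, ← Finset.sum_add_distrib, ContinuousMap.add_apply]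
  refine Finset.sum_congr rfl fun j _ => ?_
  rw [integral_add (integrable_comp_cocycle h𝔞 g j θ) (integrable_comp_cocycle h𝔞 h j θ),
    integral_add (integrable_torus g) (integrable_torus h)]
  ring

variable {ν : Measure Ω} [IsProbabilityMeasure ν]

theorem exists_norm_walkDeviation_mFourier_le (hP : IsBernoulli ν P) (h𝔞 : Continuous 𝔞)
    (herg : Ergodic (skew 𝔞) (P.prod volume)) (k : Fin d → ℤ) :
    ∃ K : ℝ, ∀ n θ, ‖walkDeviation P 𝔞 (UnitAddTorus.mFourier k) n θ‖ ≤ K := by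
  have := hP.1
  by_cases hk : k = 0
  · subst hk
    exact ⟨0, fun n θ => by simp [walkDeviation, UnitAddTorus.mFourier_zero]⟩
  set z := ∫ x, UnitAddTorus.mFourier k (𝔞 x) ∂ν with hz
  have hz1 : z ≠ 1 := integral_mFourier_ne_one hP h𝔞 herg hk
  have hzn : ‖z‖ ≤ 1 := by
    simpa using norm_integral_le_of_norm_le_const (μ := ν) (C := 1)
      (f := fun x => UnitAddTorus.mFourier k (𝔞 x)) (ae_of_all _ fun x => (norm_mFourier_apply k _).le)
  refine ⟨2 / ‖z - 1‖, fun n θ => ?_⟩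
  have : walkDeviation P 𝔞 (UnitAddTorus.mFourier k) n θ =
      UnitAddTorus.mFourier k θ * ∑ j ∈ Finset.range n, z ^ j := by
    simp only [walkDeviation, mFourier_add_apply, integral_const_mul,
      integral_mFourier_cocycle hP h𝔞, integral_mFourier_eq_zero hk, sub_zero, Finset.mul_sum, hz]
  rw [this, norm_mul, norm_mFourier_apply, one_mul, geom_sum_eq hz1, norm_div]
  gcongr
  calc ‖z ^ n - 1‖ ≤ ‖z ^ n‖ + ‖(1 : ℂ)‖ := norm_sub_le _ _
    _ ≤ 1 + 1 := by
      rw [norm_pow, norm_one]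
      gcongr
      exact pow_le_one₀ (norm_nonneg _) hzn
    _ = 2 := by norm_num

/-- Uniform equidistribution, in mean, of the random walk on the torus. -/
theorem exists_forall_norm_walkDeviation_le (hP : IsBernoulli ν P) (h𝔞 : Continuous 𝔞)
    (herg : Ergodic (skew 𝔞) (P.prod volume)) (g : C(Td d, ℂ)) {η : ℝ} (hη : 0 < η) :
    ∃ N : ℕ, ∀ n ≥ N, ∀ θ, ‖walkDeviation P 𝔞 g n θ‖ ≤ n * η := by
  have := hP.1
  have hpoly : ∀ q ∈ Submodule.span ℂ (Set.range (UnitAddTorus.mFourier (d := Fin d))),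
      ∃ K : ℝ, ∀ n θ, ‖walkDeviation P 𝔞 q n θ‖ ≤ K := by
    intro q hq
    induction hq using Submodule.span_induction with
    | mem x hx =>
      obtain ⟨k, rfl⟩ := hx
      exact exists_norm_walkDeviation_mFourier_le hP h𝔞 herg k
    | zero => exact ⟨0, fun n θ => by simp [walkDeviation]⟩
    | add x y _ _ hx hy =>
      obtain ⟨K, hK⟩ := hx
      obtain ⟨K', hK'⟩ := hy
      refine ⟨K + K', fun n θ => ?_⟩
      rw [walkDeviation_add h𝔞]
      exact (norm_add_le _ _).trans (add_le_add (hK n θ) (hK' n θ))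
    | smul c x _ hx =>
      obtain ⟨K, hK⟩ := hx
      refine ⟨‖c‖ * K, fun n θ => ?_⟩
      rw [walkDeviation_smul, norm_mul]
      exact mul_le_mul_of_nonneg_left (hK n θ) (norm_nonneg _)
  have hg : g ∈ closure (Submodule.span ℂ (Set.range (UnitAddTorus.mFourier (d := Fin d))) :
      Set C(Td d, ℂ)) := by
    rw [← Submodule.topologicalClosure_coe, UnitAddTorus.span_mFourier_closure_eq_top]
    trivial
  obtain ⟨q, hq, hgq⟩ := Metric.mem_closure_iff.1 hg (η / 4) (by positivity)
  obtain ⟨K, hK⟩ := hpoly q hq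
  obtain ⟨N, hN⟩ := exists_nat_ge (2 * K / η)
  refine ⟨N, fun n hn θ => ?_⟩
  have hn' : 2 * K / η ≤ n := hN.trans (by exact_mod_cast hn)
  rw [div_le_iff₀ hη] at hn'
  rw [dist_eq_norm] at hgq
  have h1 := norm_walkDeviation_le (P := P) (𝔞 := 𝔞) (g - q) n θ
  have h2 : (n : ℝ) * (2 * ‖g - q‖) ≤ n * (η / 2) := by gcongr; linarith
  rw [← add_sub_cancel q g, walkDeviation_add h𝔞]
  have := norm_add_le (walkDeviation P 𝔞 q n θ) (walkDeviation P 𝔞 (g - q : C(Td d, ℂ)) n θ)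
  have := hK n θ
  linarith

/-- Means of Birkhoff sums are asymptotically `n ∫ χ`, uniformly in the fibre variable. -/
theorem exists_forall_abs_integral_birkhoffSum_sub_le (hP : IsBernoulli ν P) (h𝔞 : Continuous 𝔞)
    (herg : Ergodic (skew 𝔞) (P.prod volume)) {χ : ((ℤ → Ω) × Td d) → ℝ} (hχ : Continuous χ)
    {C : ℝ} (hC : ∀ p, |χ p| ≤ C) {L : ℕ} (hL : DependsOnFirst L χ) {η : ℝ} (hη : 0 < η) :
    ∃ N : ℕ, ∀ n ≥ N, ∀ θ, |∫ ω, birkhoffSum (skew 𝔞) χ n (ω, θ) ∂P -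
      n * ∫ p, χ p ∂(P.prod volume)| ≤ n * η := by
  have := hP.1
  set u : Td d → ℝ := fun θ => ∫ ω, χ (ω, θ) ∂P with hu
  have huc : Continuous u := by
    refine continuous_of_dominated (bound := fun _ => C) (fun θ => ?_)
      (fun θ => ae_of_all _ fun ω => hC _) (integrable_const _) (ae_of_all _ fun ω => by fun_prop)
    have : Continuous fun ω => χ (ω, θ) := by fun_prop
    exact this.stronglyMeasurable.aestronglyMeasurable
  have hmean : ∫ p, χ p ∂(P.prod volume) = ∫ θ, u θ :=
    integral_prod_symm _ (Integrable.of_bound hχ.stronglyMeasurable.aestronglyMeasurable C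
      (ae_of_all _ hC))
  have hiter : ∀ j θ, ∫ ω, χ ((skew 𝔞)^[j] (ω, θ)) ∂P = ∫ ω, u (θ + cocycle 𝔞 j ω) ∂P := by
    intro j θ
    have hc : Continuous fun ω => χ ((skew 𝔞)^[j] (ω, θ)) :=
      hχ.comp (((continuous_skew h𝔞).iterate j).comp (by fun_prop))
    rw [hP.integral_eq_integral_glue j hc (fun ω => hC _)]
    simp only [hL.apply_iterate_glue, hu]
  obtain ⟨N, hN⟩ := exists_forall_norm_walkDeviation_le hP h𝔞 herg
    ⟨fun θ => (u θ : ℂ), by fun_prop⟩ hη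
  refine ⟨N, fun n hn θ => ?_⟩
  convert hN n hn θ using 1
  rw [← Real.norm_eq_abs, ← Complex.norm_real]
  have hsum : ∫ ω, birkhoffSum (skew 𝔞) χ n (ω, θ) ∂P =
      ∑ j ∈ Finset.range n, ∫ ω, u (θ + cocycle 𝔞 j ω) ∂P := by
    simp only [birkhoffSum, ← hiter]
    refine integral_finsetSum _ fun j _ => ?_
    have hc : Continuous fun ω => χ ((skew 𝔞)^[j] (ω, θ)) :=
      hχ.comp (((continuous_skew h𝔞).iterate j).comp (by fun_prop))
    exact Integrable.of_bound hc.stronglyMeasurable.aestronglyMeasurable C (ae_of_all _ fun _ => hC _)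
  rw [hsum, hmean]
  simp only [walkDeviation, ContinuousMap.coe_mk, integral_complex_ofReal]
  rw [Finset.sum_sub_distrib]
  simp

end Equidistribution

section OneSided

variable {Ω : Type*} [MetricSpace Ω] [PolishSpace Ω] [MeasurableSpace Ω] [BorelSpace Ω] {d : ℕ}
  {𝔞 : Ω → Td d}

/-- Uniform exponential decay, near `ν₀`, of the probability that the Birkhoff sums of an
observable of negative mean are nonnegative. -/
theorem exists_forall_measure_birkhoffSum_nonneg_le
    (ν₀ : Measure Ω) [IsProbabilityMeasure ν₀] (hν₀ : ∃ K : Set Ω, IsCompact K ∧ ν₀ Kᶜ = 0)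
    {P₀ : Measure (ℤ → Ω)} (hP₀ : IsBernoulli ν₀ P₀) (h𝔞 : Continuous 𝔞)
    (herg : Ergodic (skew 𝔞) (P₀.prod volume)) {χ : ((ℤ → Ω) × Td d) → ℝ}
    (hχ : Continuous χ) {C : ℝ} (hC : ∀ p, |χ p| ≤ C) {L : ℕ} (hχL : DependsOnFirst L χ)
    (hL : 0 < L) (hneg : ∫ p, χ p ∂(P₀.prod volume) < 0) :
    ∃ δ > (0 : ℝ), ∃ A : ℝ, ∃ c > (0 : ℝ), ∀ (ν : Measure Ω) [IsProbabilityMeasure ν],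
      (∃ K : Set Ω, IsCompact K ∧ ν Kᶜ = 0) → W1 ν ν₀ < δ →
        ∀ P : Measure (ℤ → Ω), IsBernoulli ν P → ∀ (θ : Td d) (n : ℕ),
          P {ω | 0 ≤ birkhoffSum (skew 𝔞) χ n (ω, θ)} ≤
            ENNReal.ofReal (Real.exp (A - c * n)) := by
  set I := ∫ p, χ p ∂(P₀.prod volume) with hI
  have hC0 : 0 ≤ C := by
    have := nonempty_of_isProbabilityMeasure ν₀
    exact (abs_nonneg _).trans (hC (Classical.arbitrary _))
  obtain ⟨N, hN⟩ := exists_forall_abs_integral_birkhoffSum_sub_le hP₀ h𝔞 herg hχ hC hχL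
    (η := -I / 2) (by linarith)
  obtain ⟨M, hMN, hM⟩ : ∃ M : ℕ, N ≤ M ∧ (L * C + 2) / (-I / 2) ≤ M := by
    obtain ⟨M, hM⟩ := exists_nat_ge ((L * C + 2) / (-I / 2))
    exact ⟨max N M, le_max_left _ _, hM.trans (by exact_mod_cast le_max_right _ _)⟩
  rw [div_le_iff₀ (by linarith)] at hM
  obtain ⟨δ, hδ, h⟩ := exists_forall_integral_bernoulli_le ν₀ hν₀ hP₀
    (continuous_birkhoffSum_skew h𝔞 hχ M) (abs_birkhoffSum_le hC M) (hχL.birkhoffSum 𝔞 M) one_pos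
  have hLpos : (0 : ℝ) < L := by exact_mod_cast hL
  set t : ℝ := 1 / (2 * ((M + L) * C + 1) ^ 2) with ht
  have htpos : 0 < t := by positivity
  refine ⟨δ, hδ, t * ((M + L) * C) + t / 2, t / (2 * (M + L)), by positivity, ?_⟩
  intro ν _ hν hW P hP θ n
  refine measure_birkhoffSum_nonneg_le hP h𝔞 hχ hC hχL hL (M := M) (fun θ => ?_) ht θ n
  have h1 := h ν hν hW P hP θ
  have h2 := (abs_le.1 (hN M hMN θ)).2
  linarith

end OneSided

section Centering

variable {α : Type*} {f : α → α} {χ : α → ℝ} {C : ℝ}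

theorem abs_birkhoffSum_comp_iterate_sub_le (hC : ∀ p, |χ p| ≤ C) (m n : ℕ) (x : α) :
    |birkhoffSum f χ n x - birkhoffSum f (χ ∘ f^[m]) n x| ≤ 2 * (m * C) := by
  have h : birkhoffSum f (χ ∘ f^[m]) n x = birkhoffSum f χ n (f^[m] x) := by
    simp only [birkhoffSum, Function.comp_apply, ← Function.iterate_add_apply, add_comm]
  have h1 := birkhoffSum_add f χ m n x
  rw [add_comm, birkhoffSum_add] at h1
  have h2 := abs_le.1 (abs_birkhoffSum_le (f := f) hC m x)
  have h3 := abs_le.1 (abs_birkhoffSum_le (f := f) hC m (f^[n] x))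
  rw [h, abs_le]
  constructor <;> linarith

theorem birkhoffSum_sub_const (χ : α → ℝ) (a : ℝ) (n : ℕ) (x : α) :
    birkhoffSum f (fun p => χ p - a) n x = birkhoffSum f χ n x - n * a := by
  simp [birkhoffSum, Finset.sum_sub_distrib]

theorem birkhoffSum_const_sub (χ : α → ℝ) (a : ℝ) (n : ℕ) (x : α) :
    birkhoffSum f (fun p => a - χ p) n x = n * a - birkhoffSum f χ n x := by
  simp [birkhoffSum, Finset.sum_sub_distrib]

theorem exists_dependsOnFirst_comp_iterate {Ω : Type*} {d : ℕ} (𝔞 : Ω → Td d)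
    {φ : ((ℤ → Ω) × Td d) → ℝ}
    (hφ : ∃ F : Finset ℤ, ∀ (ω ω' : ℤ → Ω) (θ : Td d),
      (∀ i ∈ F, ω i = ω' i) → φ (ω, θ) = φ (ω', θ)) :
    ∃ m L : ℕ, 0 < L ∧ DependsOnFirst L (φ ∘ (skew 𝔞)^[m]) := by
  obtain ⟨F, hF⟩ := hφ
  set m : ℕ := ∑ i ∈ F, i.natAbs with hm
  refine ⟨m, 2 * m + 1, by omega, fun ω ω' θ h => ?_⟩
  simp only [Function.comp_apply, skew_iterate]
  rw [cocycle_congr fun i hi => h i (by omega)]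
  refine hF _ _ _ fun i hi => ?_
  have hle : i.natAbs ≤ m := Finset.single_le_sum (f := Int.natAbs) (fun _ _ => Nat.zero_le _) hi
  have := h (i + m).toNat (by omega)
  rwa [show (((i + m).toNat : ℕ) : ℤ) = i + m by omega] at this

theorem exists_two_mul_exp_lt (A : ℝ) {c : ℝ} (hc : 0 < c) :
    ∃ N : ℕ, ∀ n : ℕ, N ≤ n → 2 * Real.exp (A - c * n) < Real.exp (-(c / 2) * n) := by
  obtain ⟨N, hN⟩ := exists_nat_gt ((A + Real.log 2) / (c / 2))
  refine ⟨N, fun n hn => ?_⟩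
  have hn1 : (A + Real.log 2) / (c / 2) < n := hN.trans_le (by exact_mod_cast hn)
  rw [div_lt_iff₀ (by positivity)] at hn1
  nth_rw 1 [← Real.exp_log (two_pos (α := ℝ))]
  rw [← Real.exp_add, Real.exp_lt_exp]
  linarith

end Centering

/-- (Base large deviations estimate, centered at the fixed
measure `ν₀`.) In the setting of the base large-deviations theorem (ergodic
`ν₀`, observable `φ` bounded, continuous and depending on finitely many
coordinates), for every `ε > 0` there are `δ > 0`, `N` and `c > 0` such that
for every compactly supported Borel probability measure `ν` with
`W₁(ν, ν₀) < δ`, every `θ` and every `n ≥ N`,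
`ν^ℤ {ω : |(1/n) ∑_{j<n} φ(f^j(ω,θ)) − ∫ φ d(ν₀^ℤ × m)| ≥ ε} < e^{-cn}`. -/
theorem base_large_deviations_fixed_centering
    {Ω : Type*} [MetricSpace Ω] [PolishSpace Ω]
    [MeasurableSpace Ω] [BorelSpace Ω] {d : ℕ}
    (ν₀ : Measure Ω) [IsProbabilityMeasure ν₀]
    (hν₀ : ∃ K : Set Ω, IsCompact K ∧ ν₀ Kᶜ = 0)
    (𝔞 : Ω → Td d) (h𝔞 : Continuous 𝔞)
    (f : ((ℤ → Ω) × Td d) → ((ℤ → Ω) × Td d))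
    (hf : f = fun p => (shiftZ Ω p.1, p.2 + 𝔞 (p.1 0)))
    (ν₀Z : Measure (ℤ → Ω)) (hν₀Z : IsBernoulli ν₀ ν₀Z)
    (herg : Ergodic f (ν₀Z.prod volume))
    (φ : ((ℤ → Ω) × Td d) → ℝ) (hφc : Continuous φ)
    (hφb : ∃ C : ℝ, ∀ p, |φ p| ≤ C)
    (hφfin : ∃ F : Finset ℤ, ∀ (ω ω' : ℤ → Ω) (θ : Td d),
      (∀ i ∈ F, ω i = ω' i) → φ (ω, θ) = φ (ω', θ)) :
    ∀ ε > (0:ℝ), ∃ δ > (0:ℝ), ∃ N : ℕ, ∃ c > (0:ℝ),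
      ∀ (ν : Measure Ω), IsProbabilityMeasure ν →
        (∃ K : Set Ω, IsCompact K ∧ ν Kᶜ = 0) →
        W1 ν ν₀ < δ →
        ∀ (νZ : Measure (ℤ → Ω)), IsBernoulli ν νZ →
          ∀ θ : Td d, ∀ n : ℕ, N ≤ n →
            νZ {ω : ℤ → Ω |
                ε ≤ |(1 / (n : ℝ)) * (∑ j ∈ Finset.range n, φ (f^[j] (ω, θ))) -
                      ∫ p, φ p ∂(ν₀Z.prod volume)|} <
              ENNReal.ofReal (Real.exp (-c * n)) := by
  intro ε hε
  have hfs : f = skew 𝔞 := hf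
  clear hf
  subst hfs
  have := hν₀Z.1
  obtain ⟨C, hC⟩ := hφb
  obtain ⟨m, L, hL, hψL⟩ := exists_dependsOnFirst_comp_iterate 𝔞 hφfin
  set ψ := φ ∘ (skew 𝔞)^[m] with hψ
  have hψc : Continuous ψ := hφc.comp ((continuous_skew h𝔞).iterate m)
  have hψC : ∀ p, |ψ p| ≤ C := fun p => hC _
  have hψint : Integrable ψ (ν₀Z.prod volume) :=
    Integrable.of_bound hψc.stronglyMeasurable.aestronglyMeasurable C (ae_of_all _ hψC)
  set I := ∫ p, φ p ∂(ν₀Z.prod volume) with hI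
  have hψI : ∫ p, ψ p ∂(ν₀Z.prod volume) = I := by
    have hmp := herg.toMeasurePreserving.iterate m
    have h := integral_map hmp.measurable.aemeasurable
      (hφc.stronglyMeasurable.aestronglyMeasurable (μ := (ν₀Z.prod volume).map (skew 𝔞)^[m]))
    rw [hmp.map_eq] at h
    exact h.symm
  obtain ⟨δ₁, hδ₁, A₁, c₁, hc₁, h₁⟩ := exists_forall_measure_birkhoffSum_nonneg_le ν₀ hν₀ hν₀Z h𝔞
    herg (χ := fun p => ψ p - (I + ε / 2)) (by fun_prop) (C := C + |I + ε / 2|) (L := L)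
    (fun p => (abs_sub _ _).trans (by gcongr; exact hψC p))
    (fun ω ω' θ h => by simp only [hψL ω ω' θ h]) hL
    (by rw [integral_sub hψint (integrable_const _), hψI]; simp; linarith)
  obtain ⟨δ₂, hδ₂, A₂, c₂, hc₂, h₂⟩ := exists_forall_measure_birkhoffSum_nonneg_le ν₀ hν₀ hν₀Z h𝔞
    herg (χ := fun p => (I - ε / 2) - ψ p) (by fun_prop) (C := |I - ε / 2| + C) (L := L)
    (fun p => (abs_sub _ _).trans (by gcongr; exact hψC p))
    (fun ω ω' θ h => by simp only [hψL ω ω' θ h]) hL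
    (by rw [integral_sub (integrable_const _) hψint, hψI]; simp; linarith)
  obtain ⟨N, hN⟩ := exists_two_mul_exp_lt (max A₁ A₂) (lt_min hc₁ hc₂)
  obtain ⟨N', hN'⟩ := exists_nat_ge (2 * (m * C) / (ε / 2))
  refine ⟨min δ₁ δ₂, lt_min hδ₁ hδ₂, max (max N N') 1, min c₁ c₂ / 2,
    half_pos (lt_min hc₁ hc₂), ?_⟩
  intro ν hνp hν hW P hP θ n hn
  have hn0 : 1 ≤ n := (le_max_right _ _).trans hn
  have hnpos : (0 : ℝ) < n := by exact_mod_cast hn0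
  have hnN : N ≤ n := (le_max_left _ _).trans ((le_max_left _ _).trans hn)
  have hnN' : 2 * (m * C) / (ε / 2) ≤ n :=
    hN'.trans (by exact_mod_cast (le_max_right _ _).trans ((le_max_left _ _).trans hn))
  rw [div_le_iff₀ (by positivity)] at hnN'
  have hsub : {ω : ℤ → Ω | ε ≤ |(1 / (n : ℝ)) *
      (∑ j ∈ Finset.range n, φ ((skew 𝔞)^[j] (ω, θ))) - I|} ⊆
      {ω | 0 ≤ birkhoffSum (skew 𝔞) (fun p => ψ p - (I + ε / 2)) n (ω, θ)} ∪
      {ω | 0 ≤ birkhoffSum (skew 𝔞) (fun p => (I - ε / 2) - ψ p) n (ω, θ)} := by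
    intro ω hω
    have hd := abs_le.1 (abs_birkhoffSum_comp_iterate_sub_le (f := skew 𝔞) hC m n (ω, θ))
    rw [← hψ] at hd
    change ε ≤ |1 / (n : ℝ) * birkhoffSum (skew 𝔞) φ n (ω, θ) - I| at hω
    simp only [Set.mem_union, Set.mem_ofPred_eq, birkhoffSum_sub_const, birkhoffSum_const_sub]
    rw [show 1 / (n : ℝ) * birkhoffSum (skew 𝔞) φ n (ω, θ) - I =
      (birkhoffSum (skew 𝔞) φ n (ω, θ) - n * I) / n by field_simp, abs_div, Nat.abs_cast,
      le_div_iff₀ hnpos, le_abs] at hω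
    rcases hω with hω | hω
    · left; linarith
    · right; linarith
  have hexp : ∀ A c : ℝ, A ≤ max A₁ A₂ → min c₁ c₂ ≤ c →
      ENNReal.ofReal (Real.exp (A - c * n)) ≤
        ENNReal.ofReal (Real.exp (max A₁ A₂ - min c₁ c₂ * n)) := fun A c hA hc => by gcongr
  calc P _ ≤ _ := (measure_mono hsub).trans (measure_union_le _ _)
    _ ≤ ENNReal.ofReal (Real.exp (max A₁ A₂ - min c₁ c₂ * n)) +
        ENNReal.ofReal (Real.exp (max A₁ A₂ - min c₁ c₂ * n)) := by
      gcongr ?_ + ?_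
      · exact (h₁ ν hν (hW.trans_le (min_le_left _ _)) P hP θ n).trans
          (hexp _ _ (le_max_left _ _) (min_le_left _ _))
      · exact (h₂ ν hν (hW.trans_le (min_le_right _ _)) P hP θ n).trans
          (hexp _ _ (le_max_right _ _) (min_le_right _ _))
    _ = ENNReal.ofReal (2 * Real.exp (max A₁ A₂ - min c₁ c₂ * n)) := by
      rw [← ENNReal.ofReal_add (Real.exp_nonneg _) (Real.exp_nonneg _), two_mul]
    _ < _ := (ENNReal.ofReal_lt_ofReal_iff (Real.exp_pos _)).2 (hN n hnN)
end
end

section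
/- Fix L < ∞ and let Ω := {(α, A) ∈ 𝕋^d × C⁰(𝕋^d, SL_m(ℝ)) : sup_θ ‖A(θ)‖ ≤ L}, X := Ω^ℤ. Let ν₀ be a compactly supported Borel probability measure on Ω such that the base map f(ω, θ) = (σω, θ + α₀) (where ω_n = (α_n, A_n)) is ergodic with respect to ν₀^ℤ × m, and let L₁(ν₀) be its maximal Lyapunov exponent. Then for every ε > 0 there exist δ > 0, n̄ ∈ ℕ and c > 0 (depending only on ε, ν₀, L) such that for every compactly supported Borel probability measure ν on Ω with W₁(ν, ν₀) < δ, every θ ∈ 𝕋^d and every n ≥ n̄: ν^ℤ{ω ∈ X : (1/n) log‖𝒜ⁿ(ω)(θ)‖ ≥ L₁(ν₀) + ε} < e^{−cn}. -/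
open MeasureTheory Filter Topology

noncomputable section

/-- The group `SL_m(ℝ)`. -/
abbrev SL (m : ℕ) := Matrix.SpecialLinearGroup (Fin m) ℝ

instance (m : ℕ) : TopologicalSpace (SL m) :=
  inferInstanceAs (TopologicalSpace {A : Matrix (Fin m) (Fin m) ℝ // A.det = 1})

/-- The space `𝒢 = 𝕋^d × C⁰(𝕋^d, SL_m(ℝ))` of quasiperiodic cocycles. -/
abbrev QPC (d m : ℕ) := Td d × C(Td d, SL m)

/-- The (ℓ² → ℓ²) operator norm of a real matrix. -/
def matOpNorm {m : ℕ} (A : Matrix (Fin m) (Fin m) ℝ) : ℝ :=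
  ‖LinearMap.toContinuousLinearMap (Matrix.toEuclideanLin A)‖

/-- The set `Ω = 𝒢_L` of quasiperiodic cocycles with fiber norm bounded by `L`. -/
def OmegaL (d m : ℕ) (L : ℝ) : Type :=
  {x : QPC d m // ∀ θ : Td d, matOpNorm ((x.2 θ : Matrix (Fin m) (Fin m) ℝ)) ≤ L}

instance (d m : ℕ) (L : ℝ) : TopologicalSpace (OmegaL d m L) :=
  inferInstanceAs (TopologicalSpace {x : QPC d m // ∀ θ : Td d,
    matOpNorm ((x.2 θ : Matrix (Fin m) (Fin m) ℝ)) ≤ L})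

instance (d m : ℕ) (L : ℝ) : MeasurableSpace (OmegaL d m L) := borel _

/-- The distance on `𝒢`: the sum of the torus distance and the uniform
(operator-norm) distance on `C⁰(𝕋^d, SL_m(ℝ))`. -/
def qpcDist {d m : ℕ} (x y : QPC d m) : ℝ :=
  dist x.1 y.1 + ⨆ θ : Td d,
    matOpNorm (((x.2 θ : Matrix (Fin m) (Fin m) ℝ)) -
      ((y.2 θ : Matrix (Fin m) (Fin m) ℝ)))

/-- The Wasserstein distance w.r.t. an explicit distance function `ρ`:
`sup {∫ g d(ν − ν') : g is 1-Lipschitz for ρ}`. -/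
def W1rho {M : Type*} [MeasurableSpace M] (ρ : M → M → ℝ)
    (ν ν' : Measure M) : ℝ :=
  sSup {r | ∃ g : M → ℝ, (∀ x y, |g x - g y| ≤ ρ x y) ∧
    r = (∫ x, g x ∂ν) - ∫ x, g x ∂ν'}

/-- The sum `α₀ + ⋯ + α_{n−1}` of the first `n` frequencies. -/
def freqSum {d m : ℕ} {L : ℝ} (ω : ℤ → OmegaL d m L) (n : ℕ) : Td d :=
  ∑ i ∈ Finset.range n, ((ω (i : ℤ)).val.1)

/-- The cocycle iterates `𝒜ⁿ(ω)(θ) = A_{n−1}(θ + α₀ + ⋯ + α_{n−2}) ⋯ A₀(θ)`. -/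
def cocycleIter {d m : ℕ} {L : ℝ} (ω : ℤ → OmegaL d m L) :
    ℕ → Td d → Matrix (Fin m) (Fin m) ℝ
  | 0 => fun _ => 1
  | n + 1 => fun θ =>
      (((ω (n : ℤ)).val.2 (θ + freqSum ω n) : Matrix (Fin m) (Fin m) ℝ)) *
        cocycleIter ω n θ

/-- The mixed random-quasiperiodic base map `f(ω, θ) = (σω, θ + α₀)`. -/
def baseMap {d m : ℕ} {L : ℝ} :
    ((ℤ → OmegaL d m L) × Td d) → ((ℤ → OmegaL d m L) × Td d) :=
  fun p => (fun n => p.1 (n + 1), p.2 + (p.1 0).val.1)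

namespace QPCocycle

open ProbabilityTheory

/-- Linear endomorphisms of the Euclidean space `ℝ^m`, with the operator norm. -/
abbrev EndE (m : ℕ) := EuclideanSpace ℝ (Fin m) →L[ℝ] EuclideanSpace ℝ (Fin m)

/-- The state space of the skew-product Markov chain `(θ, M) ↦ (θ + α, A(θ) M)`. -/
abbrev St (d m : ℕ) := Td d × EndE m

/-- The endomorphism attached to a matrix. -/
def clm {m : ℕ} (A : Matrix (Fin m) (Fin m) ℝ) : EndE m :=
  LinearMap.toContinuousLinearMap (Matrix.toEuclideanLin A)

lemma norm_clm {m : ℕ} (A : Matrix (Fin m) (Fin m) ℝ) : ‖clm A‖ = matOpNorm A := rfl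

lemma clm_eq {m : ℕ} (A : Matrix (Fin m) (Fin m) ℝ) :
    clm A = Matrix.toEuclideanCLM (𝕜 := ℝ) A := rfl

lemma clm_mul {m : ℕ} (A B : Matrix (Fin m) (Fin m) ℝ) : clm (A * B) = clm A * clm B := by
  simp [clm_eq]

lemma clm_one {m : ℕ} : clm (1 : Matrix (Fin m) (Fin m) ℝ) = 1 := by
  simp [clm_eq]

lemma clm_sub {m : ℕ} (A B : Matrix (Fin m) (Fin m) ℝ) : clm (A - B) = clm A - clm B := by
  simp [clm_eq]

lemma continuous_clm {m : ℕ} :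
    Continuous (clm : Matrix (Fin m) (Fin m) ℝ → EndE m) :=
  ((Matrix.toEuclideanLin.trans LinearMap.toContinuousLinearMap :
    Matrix (Fin m) (Fin m) ℝ ≃ₗ[ℝ] EndE m) :
    Matrix (Fin m) (Fin m) ℝ →ₗ[ℝ] EndE m).continuous_of_finiteDimensional

instance (m : ℕ) : SecondCountableTopology (SL m) :=
  inferInstanceAs (SecondCountableTopology
    {A : Fin m → Fin m → ℝ // Matrix.det (n := Fin m) A = 1})

variable {d m : ℕ} {L : ℝ}

instance : SecondCountableTopology (OmegaL d m L) :=
  TopologicalSpace.Subtype.secondCountableTopology {x : QPC d m | ∀ θ : Td d,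
    matOpNorm ((x.2 θ : Matrix (Fin m) (Fin m) ℝ)) ≤ L}

instance : BorelSpace (OmegaL d m L) := ⟨rfl⟩

lemma continuous_coe_clm : Continuous (fun A : SL m => clm (A : Matrix (Fin m) (Fin m) ℝ)) :=
  continuous_clm.comp continuous_subtype_val

/-- The fiber map of a cocycle, with values in the endomorphisms of `ℝ^m`. -/
def fib (a : OmegaL d m L) : C(Td d, EndE m) :=
  (⟨fun A : SL m => clm (A : Matrix (Fin m) (Fin m) ℝ), continuous_coe_clm⟩ :
    C(SL m, EndE m)).comp a.val.2

/-- The frequency of a cocycle. -/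
def freq (a : OmegaL d m L) : Td d := a.val.1

lemma continuous_fib : Continuous (fib : OmegaL d m L → C(Td d, EndE m)) :=
  (ContinuousMap.continuous_postcomp _).comp (continuous_snd.comp continuous_subtype_val)

lemma continuous_freq : Continuous (freq : OmegaL d m L → Td d) :=
  continuous_fst.comp continuous_subtype_val

lemma norm_fib_le (a : OmegaL d m L) (θ : Td d) : ‖fib a θ‖ ≤ L := a.property θ

lemma qpcDist_eq (a b : OmegaL d m L) :
    qpcDist a.val b.val = dist (freq a) (freq b) + dist (fib a) (fib b) := by
  rw [dist_eq_norm (fib a), ContinuousMap.norm_eq_iSup_norm]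
  simp only [qpcDist, ← norm_clm, clm_sub]
  rfl

/-- One step of the skew-product `(θ, M) ↦ (θ + α, A(θ) M)`. -/
def step (a : OmegaL d m L) (s : St d m) : St d m := (s.1 + freq a, fib a s.1 * s.2)

lemma continuous_step : Continuous (fun p : OmegaL d m L × St d m => step p.1 p.2) := by
  have h : Continuous (fun p : OmegaL d m L × St d m => fib p.1 p.2.1) := by
    have := continuous_fib (d := d) (m := m) (L := L)
    fun_prop
  have := continuous_freq (d := d) (m := m) (L := L)
  unfold step
  fun_prop

lemma norm_step_snd_le (a : OmegaL d m L) (s : St d m) : ‖(step a s).2‖ ≤ L * ‖s.2‖ :=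
  (norm_mul_le _ _).trans (by gcongr; exact norm_fib_le _ _)

/-- A continuous function is bounded on states whose matrix part is bounded. -/
lemma exists_bound {𝕜 : Type*} [RCLike 𝕜] (G : C(St d m, 𝕜)) (R : ℝ) :
    ∃ B, 0 ≤ B ∧ ∀ s : St d m, ‖s.2‖ ≤ R → ‖G s‖ ≤ B := by
  obtain ⟨B, hB⟩ := ((isCompact_univ (X := Td d)).prod
    (isCompact_closedBall (0 : EndE m) R)).exists_bound_of_continuousOn
      G.continuous.continuousOn
  exact ⟨max B 0, le_max_right _ _, fun s hs => (hB s ⟨trivial, by simpa using hs⟩).trans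
    (le_max_left _ _)⟩

section Operator

variable {𝕜 : Type*} [RCLike 𝕜]

lemma continuous_step_left (s : St d m) : Continuous (fun a : OmegaL d m L => step a s) :=
  continuous_step.comp (by fun_prop : Continuous fun a : OmegaL d m L => (a, s))

lemma continuous_step_right (a : OmegaL d m L) : Continuous (step a) :=
  continuous_step.comp (by fun_prop : Continuous fun s : St d m => (a, s))

lemma aestronglyMeasurable_of_continuous {X : Type*} [TopologicalSpace X] [MeasurableSpace X]
    [OpensMeasurableSpace X] {ν : Measure X} {g : X → 𝕜} (hg : Continuous g) :
    AEStronglyMeasurable g ν :=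
  hg.measurable.aestronglyMeasurable

lemma integrable_step (ν : Measure (OmegaL d m L)) [IsProbabilityMeasure ν]
    (G : C(St d m, 𝕜)) (s : St d m) : Integrable (fun a => G (step a s)) ν := by
  obtain ⟨B, -, hB⟩ := exists_bound G (L * ‖s.2‖)
  exact Integrable.of_bound (aestronglyMeasurable_of_continuous
    (G.continuous.comp (continuous_step_left s))) B
    (ae_of_all _ fun a => hB _ (norm_step_snd_le a s))

/-- The Markov operator of the skew-product driven by `ν`. -/
def stepOp (𝕜 : Type*) [RCLike 𝕜] (ν : Measure (OmegaL d m L)) [IsProbabilityMeasure ν] :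
    C(St d m, 𝕜) →ₗ[𝕜] C(St d m, 𝕜) where
  toFun G :=
    { toFun := fun s => ∫ a, G (step a s) ∂ν
      continuous_toFun := by
        rw [continuous_iff_continuousAt]
        intro s
        obtain ⟨B, -, hB⟩ := exists_bound G (|L| * (‖s.2‖ + 1))
        refine continuousAt_of_dominated (bound := fun _ => B) ?_ ?_ (integrable_const _) ?_
        · exact Eventually.of_forall fun s => (integrable_step ν G s).aestronglyMeasurable
        · have : ∀ᶠ t : St d m in 𝓝 s, ‖t.2‖ < ‖s.2‖ + 1 :=
            (by fun_prop : Continuous fun t : St d m => ‖t.2‖).continuousAt.eventually_lt_const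
              (by simp)
          filter_upwards [this] with t ht
          refine ae_of_all _ fun a => hB _ ((norm_step_snd_le a t).trans ?_)
          exact mul_le_mul (le_abs_self L) ht.le (norm_nonneg _) (abs_nonneg _)
        · exact ae_of_all _ fun a =>
            (G.continuous.comp (continuous_step_right a)).continuousAt }
  map_add' G H := by
    ext s
    exact integral_add (integrable_step ν G s) (integrable_step ν H s)
  map_smul' c G := by
    ext s
    exact integral_const_mul c _

lemma stepOp_apply (ν : Measure (OmegaL d m L)) [IsProbabilityMeasure ν] (G : C(St d m, 𝕜))
    (s : St d m) : stepOp 𝕜 ν G s = ∫ a, G (step a s) ∂ν := rfl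

/-- The orbit of the skew-product started at `(θ, 1)`. -/
def orb (θ : Td d) (ω : ℤ → OmegaL d m L) : ℕ → St d m
  | 0 => (θ, 1)
  | n + 1 => step (ω n) (orb θ ω n)

lemma orb_eq (θ : Td d) (ω : ℤ → OmegaL d m L) (n : ℕ) :
    orb θ ω n = (θ + freqSum ω n, clm (cocycleIter ω n θ)) := by
  induction n with
  | zero => simp [orb, freqSum, cocycleIter, clm_one]
  | succ n ih =>
    rw [orb, ih, step, cocycleIter, clm_mul]
    simp only [freqSum, Finset.sum_range_succ, add_assoc]
    rfl

lemma norm_orb_le (θ : Td d) (ω : ℤ → OmegaL d m L) (n : ℕ) :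
    Real.posLog ‖(orb θ ω n).2‖ ≤ n * Real.posLog L := by
  induction n with
  | zero =>
    have : ‖(1 : EndE m)‖ ≤ 1 := ContinuousLinearMap.norm_id_le
    simp only [orb, Nat.cast_zero, zero_mul]
    exact (Real.posLog_le_posLog (norm_nonneg _) this).trans (by simp)
  | succ n ih =>
    have h1 := Real.posLog_le_posLog (norm_nonneg _) (norm_step_snd_le (ω n) (orb θ ω n))
    have h2 := Real.posLog_mul (x := L) (y := ‖(orb θ ω n).2‖)
    rw [orb]
    push_cast
    linarith

lemma norm_orb_le_max_pow (θ : Td d) (ω : ℤ → OmegaL d m L) (n : ℕ) :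
    ‖(orb θ ω n).2‖ ≤ max L 1 ^ n := by
  induction n with
  | zero =>
    rw [pow_zero]
    exact ContinuousLinearMap.norm_id_le
  | succ n ih =>
    rw [orb, pow_succ']
    refine (norm_step_snd_le (ω n) (orb θ ω n)).trans ?_
    exact mul_le_mul (le_max_left _ _) ih (norm_nonneg _) (by positivity)

lemma continuous_orb (n : ℕ) :
    Continuous (fun p : (ℤ → OmegaL d m L) × Td d => orb p.2 p.1 n) := by
  induction n with
  | zero => simp only [orb]; fun_prop
  | succ n ih =>
    simp only [orb]
    exact continuous_step.comp (((continuous_apply (n : ℤ)).comp continuous_fst).prodMk ih)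

lemma continuous_orb_left (θ : Td d) (n : ℕ) :
    Continuous (fun ω : ℤ → OmegaL d m L => orb θ ω n) :=
  (continuous_orb n).comp (by fun_prop : Continuous fun ω : ℤ → OmegaL d m L => (ω, θ))

lemma orb_congr (θ : Td d) {ω ω' : ℤ → OmegaL d m L} {n : ℕ}
    (h : ∀ i < n, ω (i : ℤ) = ω' (i : ℤ)) : orb θ ω n = orb θ ω' n := by
  induction n with
  | zero => rfl
  | succ n ih =>
    rw [orb, orb, ih fun i hi => h i (by omega), h n (by omega)]

lemma integrable_orb (P : Measure (ℤ → OmegaL d m L)) [IsProbabilityMeasure P]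
    (G : C(St d m, 𝕜)) (θ : Td d) (n : ℕ) : Integrable (fun ω => G (orb θ ω n)) P := by
  obtain ⟨B, -, hB⟩ := exists_bound G (max L 1 ^ n)
  exact Integrable.of_bound (aestronglyMeasurable_of_continuous
    (G.continuous.comp (continuous_orb_left θ n))) B
    (ae_of_all _ fun ω => hB _ (norm_orb_le_max_pow θ ω n))

end Operator

section Bernoulli

variable {ν : Measure (OmegaL d m L)} {P : Measure (ℤ → OmegaL d m L)}

lemma map_eval_of_isBernoulli (hP : IsBernoulli ν P) (i : ℤ) :
    P.map (fun ω => ω i) = ν := by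
  ext E hE
  rw [Measure.map_apply (measurable_pi_apply i) hE]
  have h := hP.2 {i} (fun _ => E) fun _ => hE
  simp only [Finset.mem_singleton, forall_eq, Finset.prod_singleton] at h
  exact h

lemma iIndepFun_of_isBernoulli (hP : IsBernoulli ν P) :
    iIndepFun (fun (i : ℤ) (ω : ℤ → OmegaL d m L) => ω i) P := by
  classical
  rw [iIndepFun_iff_measure_inter_preimage_eq_mul]
  intro S sets hS
  have h := hP.2 S (fun i => if i ∈ S then sets i else Set.univ) fun i => by
    by_cases hi : i ∈ S <;> simp [hi, hS]
  have e1 : (⋂ i ∈ S, (fun ω : ℤ → OmegaL d m L => ω i) ⁻¹' sets i) =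
      {ω | ∀ i ∈ S, ω i ∈ if i ∈ S then sets i else Set.univ} := by
    ext ω
    simp +contextual
  rw [e1, h]
  refine Finset.prod_congr rfl fun i hi => ?_
  rw [if_pos hi, ← map_eval_of_isBernoulli hP i, Measure.map_apply (measurable_pi_apply i)
    (hS i hi)]

lemma indepFun_orb (hP : IsBernoulli ν P) (θ : Td d) (n : ℕ) :
    IndepFun (fun ω : ℤ → OmegaL d m L => ω n) (fun ω => orb θ ω n) P := by
  classical
  have := hP.1
  obtain ⟨ω₀⟩ : Nonempty (ℤ → OmegaL d m L) := nonempty_of_isProbabilityMeasure P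
  let S : Finset ℤ := {(n : ℤ)}
  let T : Finset ℤ := (Finset.range n).image (fun i : ℕ => (i : ℤ))
  have hST : Disjoint S T := by
    simp [S, T]
  have key := (iIndepFun_of_isBernoulli hP).indepFun_finset S T hST measurable_pi_apply
  let ext : (T → OmegaL d m L) → ℤ → OmegaL d m L :=
    fun x i => if h : i ∈ T then x ⟨i, h⟩ else ω₀ i
  have hext : Measurable ext := by
    refine measurable_pi_lambda _ fun i => ?_
    by_cases h : i ∈ T
    · simp only [ext, h, dite_true]; exact measurable_pi_apply _
    · simp only [ext, h, dite_false]; exact measurable_const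
  have h1 : Measurable (fun x : S → OmegaL d m L => x ⟨n, by simp [S]⟩) := measurable_pi_apply _
  have h2 : Measurable (fun x : T → OmegaL d m L => orb θ (ext x) n) :=
    (continuous_orb_left θ n).measurable.comp hext
  have horb : (fun ω => orb θ ω n) = (fun x : T → OmegaL d m L => orb θ (ext x) n) ∘
      fun (ω : ℤ → OmegaL d m L) (i : T) => ω i := by
    ext1 ω
    refine orb_congr θ fun i hi => ?_
    have : (i : ℤ) ∈ T := by simp [T, hi]
    simp [ext, this]
  rw [horb]
  exact key.comp h1 h2

lemma integral_orb {𝕜 : Type*} [RCLike 𝕜] [IsProbabilityMeasure ν] (hP : IsBernoulli ν P)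
    (θ : Td d) (n : ℕ) (G : C(St d m, 𝕜)) :
    ∫ ω, G (orb θ ω n) ∂P = (stepOp 𝕜 ν ^ n) G (θ, 1) := by
  have := hP.1
  induction n generalizing G with
  | zero => simp [orb]
  | succ n ih =>
    rw [pow_succ, Module.End.mul_apply, ← ih (stepOp 𝕜 ν G)]
    have hm1 : Measurable (fun ω : ℤ → OmegaL d m L => ω n) := measurable_pi_apply _
    have hm2 : Measurable (fun ω : ℤ → OmegaL d m L => orb θ ω n) :=
      (continuous_orb_left θ n).measurable
    have hprod := (indepFun_iff_map_prod_eq_prod_map_map hm1.aemeasurable hm2.aemeasurable).1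
      (indepFun_orb hP θ n)
    rw [map_eval_of_isBernoulli hP] at hprod
    have hc : Continuous fun p : OmegaL d m L × St d m => G (step p.1 p.2) :=
      G.continuous.comp continuous_step
    have hi : Integrable (fun p : OmegaL d m L × St d m => G (step p.1 p.2))
        (ν.prod (P.map fun ω => orb θ ω n)) := by
      rw [← hprod, integrable_map_measure (aestronglyMeasurable_of_continuous hc)
        (hm1.prodMk hm2).aemeasurable]
      exact integrable_orb P G θ (n + 1)
    have : IsProbabilityMeasure (P.map fun ω => orb θ ω n) :=
      Measure.isProbabilityMeasure_map hm2.aemeasurable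
    calc ∫ ω, G (orb θ ω (n + 1)) ∂P
        = ∫ p, G (step p.1 p.2) ∂(P.map fun ω => (ω n, orb θ ω n)) := by
          rw [integral_map (hm1.prodMk hm2).aemeasurable (aestronglyMeasurable_of_continuous hc)]
          rfl
      _ = ∫ s, ∫ a, G (step a s) ∂ν ∂(P.map fun ω => orb θ ω n) := by
          rw [hprod, integral_prod_symm _ hi]
      _ = ∫ ω, stepOp 𝕜 ν G (orb θ ω n) ∂P :=
          integral_map hm2.aemeasurable (aestronglyMeasurable_of_continuous
            (stepOp 𝕜 ν G).continuous)

end Bernoulli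

section Wasserstein

lemma qpcDist_nonneg (a b : OmegaL d m L) : 0 ≤ qpcDist a.val b.val := by
  rw [qpcDist_eq]; positivity

lemma qpcDist_self (a : OmegaL d m L) : qpcDist a.val a.val = 0 := by
  simp [qpcDist_eq]

lemma qpcDist_comm (a b : OmegaL d m L) : qpcDist a.val b.val = qpcDist b.val a.val := by
  simp [qpcDist_eq, dist_comm]

lemma qpcDist_triangle (a b c : OmegaL d m L) :
    qpcDist a.val c.val ≤ qpcDist a.val b.val + qpcDist b.val c.val := by
  simp only [qpcDist_eq]
  linarith [dist_triangle (freq a) (freq b) (freq c), dist_triangle (fib a) (fib b) (fib c)]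

lemma exists_qpcDist_le (d m : ℕ) (L : ℝ) :
    ∃ D, ∀ a b : OmegaL d m L, qpcDist a.val b.val ≤ D := by
  refine ⟨Metric.diam (Set.univ : Set (Td d)) + (|L| + |L|), fun a b => ?_⟩
  rw [qpcDist_eq]
  gcongr
  · exact Metric.dist_le_diam_of_mem isCompact_univ.isBounded trivial trivial
  · rw [ContinuousMap.dist_le (by positivity)]
    intro θ
    rw [dist_eq_norm]
    exact (norm_sub_le _ _).trans (add_le_add ((norm_fib_le a θ).trans (le_abs_self L))
      ((norm_fib_le b θ).trans (le_abs_self L)))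

lemma continuous_of_abs_sub_le_qpcDist {g : OmegaL d m L → ℝ}
    (hg : ∀ x y, |g x - g y| ≤ qpcDist x.val y.val) : Continuous g := by
  rw [continuous_iff_continuousAt]
  intro x
  rw [ContinuousAt, tendsto_iff_dist_tendsto_zero]
  have hc : Continuous fun y : OmegaL d m L => qpcDist y.val x.val := by
    simp only [qpcDist_eq]
    have := continuous_freq (d := d) (m := m) (L := L)
    have := continuous_fib (d := d) (m := m) (L := L)
    fun_prop
  refine squeeze_zero (fun _ => dist_nonneg) (fun y => hg y x) ?_
  simpa only [qpcDist_self] using hc.tendsto x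

lemma integrable_of_abs_sub_le_qpcDist (ν : Measure (OmegaL d m L)) [IsProbabilityMeasure ν]
    {g : OmegaL d m L → ℝ} (hg : ∀ x y, |g x - g y| ≤ qpcDist x.val y.val) :
    Integrable g ν := by
  obtain ⟨a₀⟩ : Nonempty (OmegaL d m L) := nonempty_of_isProbabilityMeasure ν
  obtain ⟨D, hD⟩ := exists_qpcDist_le d m L
  refine Integrable.of_bound (continuous_of_abs_sub_le_qpcDist hg).aestronglyMeasurable
    (|g a₀| + D) (ae_of_all _ fun a => ?_)
  have h1 := hg a a₀
  have h2 := hD a a₀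
  have h3 := abs_sub_abs_le_abs_sub (g a) (g a₀)
  rw [Real.norm_eq_abs]
  linarith

lemma integral_sub_le_W1rho (ν ν₀ : Measure (OmegaL d m L)) [IsProbabilityMeasure ν]
    [IsProbabilityMeasure ν₀] {g : OmegaL d m L → ℝ}
    (hg : ∀ x y, |g x - g y| ≤ qpcDist x.val y.val) :
    (∫ x, g x ∂ν) - ∫ x, g x ∂ν₀ ≤ W1rho (fun x y => qpcDist x.val y.val) ν ν₀ := by
  obtain ⟨a₀⟩ : Nonempty (OmegaL d m L) := nonempty_of_isProbabilityMeasure ν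
  obtain ⟨D, hD⟩ := exists_qpcDist_le d m L
  refine le_csSup ⟨D + D, ?_⟩ ⟨g, hg, rfl⟩
  rintro _ ⟨f, hf, rfl⟩
  have h1 : ∫ x, f x ∂ν ≤ ∫ _, (f a₀ + D) ∂ν :=
    integral_mono (integrable_of_abs_sub_le_qpcDist ν hf) (integrable_const _) fun x => by
      linarith [le_abs_self (f x - f a₀), hf x a₀, hD x a₀]
  have h2 : ∫ _, (f a₀ - D) ∂ν₀ ≤ ∫ x, f x ∂ν₀ :=
    integral_mono (integrable_const _) (integrable_of_abs_sub_le_qpcDist ν₀ hf) fun x => by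
      linarith [neg_abs_le (f x - f a₀), hf x a₀, hD x a₀]
  simp only [integral_const, probReal_univ, one_smul] at h1 h2
  linarith

/-- Comparison of integrals of an observable with a given modulus of continuity: the sup-convolution
of the observable with a multiple of the distance is Lipschitz. -/
lemma integral_le_of_modulus (ν ν₀ : Measure (OmegaL d m L)) [IsProbabilityMeasure ν]
    [IsProbabilityMeasure ν₀] {h : OmegaL d m L → ℝ} (hc : Continuous h) {B η r δ : ℝ}
    (hr : 0 < r) (hη : 0 ≤ η) (hB : ∀ a, |h a| ≤ B)
    (hmod : ∀ a b : OmegaL d m L, qpcDist a.val b.val < r → h b ≤ h a + η)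
    (hW : W1rho (fun x y : OmegaL d m L => qpcDist x.val y.val) ν ν₀ < δ) :
    ∫ a, h a ∂ν ≤ ∫ a, h a ∂ν₀ + η + (2 * B / r + 1) * δ := by
  obtain ⟨a₀⟩ : Nonempty (OmegaL d m L) := nonempty_of_isProbabilityMeasure ν
  have hB0 : 0 ≤ B := (abs_nonneg _).trans (hB a₀)
  set Λ : ℝ := 2 * B / r + 1 with hΛ
  have hΛ0 : 0 < Λ := by positivity
  have hΛr : 2 * B ≤ Λ * r := by
    have : Λ * r = 2 * B + r := by rw [hΛ]; field_simp
    linarith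
  let H : OmegaL d m L → ℝ := fun a => ⨆ b : OmegaL d m L, h b - Λ * qpcDist a.val b.val
  have hbdd : ∀ a : OmegaL d m L, BddAbove (Set.range fun b : OmegaL d m L =>
      h b - Λ * qpcDist a.val b.val) := by
    intro a
    refine ⟨B, ?_⟩
    rintro _ ⟨b, rfl⟩
    have := mul_nonneg hΛ0.le (qpcDist_nonneg a b)
    have := (abs_le.1 (hB b)).2
    dsimp only
    linarith
  have hne : Nonempty (OmegaL d m L) := ⟨a₀⟩
  have hle : ∀ a, h a ≤ H a := fun a => by
    have := le_ciSup (hbdd a) a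
    simpa [qpcDist_self] using this
  have hge : ∀ a, H a ≤ h a + η := fun a => ciSup_le fun b => by
    have hρ := qpcDist_nonneg a b
    rcases lt_or_ge (qpcDist a.val b.val) r with hlt | hlt
    · have := hmod a b hlt
      have := mul_nonneg hΛ0.le hρ
      linarith
    · have h1 := (abs_le.1 (hB b)).2
      have h2 := (abs_le.1 (hB a)).1
      have := mul_le_mul_of_nonneg_left hlt hΛ0.le
      linarith
  have hlip1 : ∀ a a' : OmegaL d m L, H a ≤ H a' + Λ * qpcDist a.val a'.val := by
    refine fun a a' => ciSup_le fun b => ?_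
    have h1 := le_ciSup (hbdd a') b
    have h2 := mul_le_mul_of_nonneg_left (qpcDist_triangle a' a b) hΛ0.le
    rw [mul_add, qpcDist_comm a' a] at h2
    change h b - Λ * qpcDist a'.val b.val ≤ H a' at h1
    linarith
  have hlip : ∀ a a' : OmegaL d m L, |Λ⁻¹ * H a - Λ⁻¹ * H a'| ≤ qpcDist a.val a'.val := by
    intro a a'
    rw [← mul_sub, abs_mul, abs_of_pos (inv_pos.2 hΛ0), inv_mul_le_iff₀ hΛ0, abs_le]
    have h1 := hlip1 a a'
    have h2 := hlip1 a' a
    rw [qpcDist_comm a' a] at h2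
    constructor <;> linarith
  have hHint : ∀ (μ : Measure (OmegaL d m L)) [IsProbabilityMeasure μ], Integrable H μ := by
    intro μ _
    have := (integrable_of_abs_sub_le_qpcDist μ hlip).const_mul Λ
    simpa [← mul_assoc, hΛ0.ne'] using this
  have hhint : ∀ (μ : Measure (OmegaL d m L)) [IsProbabilityMeasure μ], Integrable h μ :=
    fun μ _ => Integrable.of_bound hc.aestronglyMeasurable B (ae_of_all _ hB)
  have hW' := (integral_sub_le_W1rho ν ν₀ hlip).trans hW.le
  rw [integral_const_mul, integral_const_mul, ← mul_sub, inv_mul_le_iff₀ hΛ0] at hW'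
  have h1 := integral_mono (hhint ν) (hHint ν) hle
  have h2 := integral_mono (hHint ν₀) ((hhint ν₀).add (integrable_const η)) hge
  simp only [Pi.add_apply] at h2
  rw [integral_add (hhint ν₀) (integrable_const η)] at h2
  simp only [integral_const, probReal_univ, one_smul] at h2
  linarith

end Wasserstein

section Perturbation

lemma stepOp_mono (ν : Measure (OmegaL d m L)) [IsProbabilityMeasure ν] {G H : C(St d m, ℝ)}
    (h : ∀ s, G s ≤ H s) (s : St d m) : stepOp ℝ ν G s ≤ stepOp ℝ ν H s :=
  integral_mono (integrable_step ν G s) (integrable_step ν H s) fun _ => h _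

lemma stepOp_pow_mono (ν : Measure (OmegaL d m L)) [IsProbabilityMeasure ν] (n : ℕ)
    {G H : C(St d m, ℝ)} (h : ∀ s, G s ≤ H s) (s : St d m) :
    (stepOp ℝ ν ^ n) G s ≤ (stepOp ℝ ν ^ n) H s := by
  induction n generalizing s with
  | zero => exact h s
  | succ n ih =>
    rw [pow_succ', Module.End.mul_apply, Module.End.mul_apply]
    exact stepOp_mono ν ih s

lemma stepOp_perturb (ν₀ : Measure (OmegaL d m L)) [IsProbabilityMeasure ν₀] (G : C(St d m, ℝ))
    (R : ℝ) {η : ℝ} (hη : 0 < η) :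
    ∃ δ > 0, ∀ (ν : Measure (OmegaL d m L)) [IsProbabilityMeasure ν],
      W1rho (fun x y : OmegaL d m L => qpcDist x.val y.val) ν ν₀ < δ →
      ∀ s : St d m, ‖s.2‖ ≤ R → stepOp ℝ ν G s ≤ stepOp ℝ ν₀ G s + η := by
  have hL : 0 ≤ L := by
    obtain ⟨a⟩ : Nonempty (OmegaL d m L) := nonempty_of_isProbabilityMeasure ν₀
    exact (norm_nonneg _).trans (norm_fib_le a 0)
  obtain ⟨B, hB0, hB⟩ := exists_bound G (L * R)
  have hK : IsCompact ((Set.univ : Set (Td d)) ×ˢ Metric.closedBall (0 : EndE m) (L * R)) :=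
    isCompact_univ.prod (isCompact_closedBall _ _)
  have huc := hK.uniformContinuousOn_of_continuous G.continuous.continuousOn
  obtain ⟨r, hr, hG⟩ := Metric.uniformContinuousOn_iff.1 huc (η / 2) (by positivity)
  set r' : ℝ := r / (|R| + 1) with hr'
  have hr'0 : 0 < r' := by positivity
  refine ⟨η / 2 / (2 * B / r' + 1), by positivity, fun ν _ hW s hs => ?_⟩
  have hmem : ∀ a : OmegaL d m L, ‖(step a s).2‖ ≤ L * R := fun a =>
    (norm_step_snd_le a s).trans (by gcongr)
  have key := integral_le_of_modulus ν ν₀ (h := fun a => G (step a s))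
    (G.continuous.comp (continuous_step_left s)) hr'0 (half_pos hη).le
    (fun a => hB _ (hmem a)) ?_ hW
  · rw [mul_div_cancel₀ _ (by positivity : 2 * B / r' + 1 ≠ 0)] at key
    rw [stepOp_apply, stepOp_apply]
    linarith
  · intro a b hab
    have hd : dist (step b s) (step a s) < r := by
      have hR : qpcDist a.val b.val * (|R| + 1) < r := by
        rwa [hr', lt_div_iff₀ (by positivity)] at hab
      have hsR : ‖s.2‖ ≤ |R| := hs.trans (le_abs_self R)
      rw [qpcDist_eq] at hR
      have e1 := dist_nonneg (x := freq a) (y := freq b)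
      have e2 := dist_nonneg (x := fib a) (y := fib b)
      have e3 := abs_nonneg R
      rw [Prod.dist_eq, max_lt_iff]
      constructor
      · simp only [step, dist_add_left]
        rw [dist_comm]
        nlinarith
      · simp only [step]
        rw [dist_eq_norm, ← sub_mul]
        refine lt_of_le_of_lt (norm_mul_le _ _) ?_
        have e4 : ‖fib b s.1 - fib a s.1‖ ≤ dist (fib a) (fib b) := by
          rw [← dist_eq_norm, dist_comm]
          exact ContinuousMap.dist_apply_le_dist _
        have e5 : ‖fib b s.1 - fib a s.1‖ * ‖s.2‖ ≤ dist (fib a) (fib b) * |R| := by gcongr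
        nlinarith
    have := hG (step b s) ⟨trivial, by simpa using hmem b⟩ (step a s)
      ⟨trivial, by simpa using hmem a⟩ hd
    rw [Real.dist_eq] at this
    linarith [le_abs_self (G (step b s) - G (step a s))]

lemma stepOp_pow_perturb (ν₀ : Measure (OmegaL d m L)) [IsProbabilityMeasure ν₀]
    (G : C(St d m, ℝ)) (n : ℕ) (R : ℝ) {η : ℝ} (hη : 0 < η) :
    ∃ δ > 0, ∀ (ν : Measure (OmegaL d m L)) [IsProbabilityMeasure ν],
      W1rho (fun x y : OmegaL d m L => qpcDist x.val y.val) ν ν₀ < δ →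
      ∀ s : St d m, ‖s.2‖ ≤ R → (stepOp ℝ ν ^ n) G s ≤ (stepOp ℝ ν₀ ^ n) G s + η := by
  have hL : 0 ≤ L := by
    obtain ⟨a⟩ : Nonempty (OmegaL d m L) := nonempty_of_isProbabilityMeasure ν₀
    exact (norm_nonneg _).trans (norm_fib_le a 0)
  induction n generalizing R η with
  | zero => exact ⟨1, one_pos, fun ν _ _ s _ => by simp [hη.le]⟩
  | succ n ih =>
    obtain ⟨δ₁, hδ₁, h₁⟩ := ih (L * R) (half_pos hη)
    obtain ⟨δ₂, hδ₂, h₂⟩ := stepOp_perturb ν₀ ((stepOp ℝ ν₀ ^ n) G) R (half_pos hη)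
    refine ⟨min δ₁ δ₂, lt_min hδ₁ hδ₂, fun ν _ hW s hs => ?_⟩
    have i₁ := h₁ ν (hW.trans_le (min_le_left _ _))
    have i₂ := h₂ ν (hW.trans_le (min_le_right _ _)) s hs
    rw [pow_succ', pow_succ', Module.End.mul_apply, Module.End.mul_apply]
    have : stepOp ℝ ν ((stepOp ℝ ν ^ n) G) s ≤ stepOp ℝ ν ((stepOp ℝ ν₀ ^ n) G) s + η / 2 := by
      have hmono := integral_mono (integrable_step ν ((stepOp ℝ ν ^ n) G) s)
        ((integrable_step ν ((stepOp ℝ ν₀ ^ n) G) s).add (integrable_const (η / 2))) fun a =>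
          i₁ (step a s) ((norm_step_snd_le a s).trans (by gcongr))
      simp only [Pi.add_apply] at hmono
      rw [integral_add (integrable_step _ _ _) (integrable_const _)] at hmono
      simpa [stepOp_apply] using hmono
    linarith

end Perturbation

section Rotation

variable {𝕜 : Type*} [RCLike 𝕜]

/-- The Markov operator of the random rotation `θ ↦ θ + α` on the torus. -/
def rotOp (𝕜 : Type*) [RCLike 𝕜] (ν : Measure (OmegaL d m L)) [IsProbabilityMeasure ν] :
    C(Td d, 𝕜) →ₗ[𝕜] C(Td d, 𝕜) where
  toFun u :=
    { toFun := fun θ => ∫ a, u (θ + freq a) ∂ν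
      continuous_toFun := (stepOp 𝕜 ν (u.comp ⟨Prod.fst, continuous_fst⟩)).continuous.comp
        (by fun_prop : Continuous fun θ : Td d => (θ, (1 : EndE m))) }
  map_add' u v := by
    ext θ
    exact integral_add (integrable_step ν (u.comp ⟨Prod.fst, continuous_fst⟩) (θ, 1))
      (integrable_step ν (v.comp ⟨Prod.fst, continuous_fst⟩) (θ, 1))
  map_smul' c u := by
    ext θ
    exact integral_const_mul c _

lemma rotOp_apply (ν : Measure (OmegaL d m L)) [IsProbabilityMeasure ν] (u : C(Td d, 𝕜))
    (θ : Td d) : rotOp 𝕜 ν u θ = ∫ a, u (θ + freq a) ∂ν := rfl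

lemma stepOp_pow_comp_fst (ν : Measure (OmegaL d m L)) [IsProbabilityMeasure ν] (n : ℕ)
    (u : C(Td d, 𝕜)) (s : St d m) :
    (stepOp 𝕜 ν ^ n) (u.comp ⟨Prod.fst, continuous_fst⟩) s = (rotOp 𝕜 ν ^ n) u s.1 := by
  induction n generalizing s with
  | zero => rfl
  | succ n ih =>
    rw [pow_succ', pow_succ', Module.End.mul_apply, Module.End.mul_apply, stepOp_apply,
      rotOp_apply]
    simp only [ih, step]

lemma norm_rotOp_le (ν : Measure (OmegaL d m L)) [IsProbabilityMeasure ν] (u : C(Td d, 𝕜)) :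
    ‖rotOp 𝕜 ν u‖ ≤ ‖u‖ := by
  rw [ContinuousMap.norm_le _ (norm_nonneg _)]
  intro θ
  refine (norm_integral_le_of_norm_le_const (ae_of_all _ fun a =>
    ContinuousMap.norm_coe_le_norm u (θ + freq a))).trans ?_
  simp

lemma norm_rotOp_pow_le (ν : Measure (OmegaL d m L)) [IsProbabilityMeasure ν] (n : ℕ)
    (u : C(Td d, 𝕜)) : ‖(rotOp 𝕜 ν ^ n) u‖ ≤ ‖u‖ := by
  induction n with
  | zero => simp
  | succ n ih =>
    rw [pow_succ', Module.End.mul_apply]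
    exact (norm_rotOp_le ν _).trans ih

/-- Birkhoff averages of the random rotation operator. -/
def rotAvg (𝕜 : Type*) [RCLike 𝕜] (ν : Measure (OmegaL d m L)) [IsProbabilityMeasure ν] (N : ℕ) :
    C(Td d, 𝕜) →ₗ[𝕜] C(Td d, 𝕜) :=
  (N : 𝕜)⁻¹ • ∑ j ∈ Finset.range N, rotOp 𝕜 ν ^ j

lemma rotAvg_apply (ν : Measure (OmegaL d m L)) [IsProbabilityMeasure ν] (N : ℕ)
    (u : C(Td d, 𝕜)) :
    rotAvg 𝕜 ν N u = (N : 𝕜)⁻¹ • ∑ j ∈ Finset.range N, (rotOp 𝕜 ν ^ j) u := by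
  simp [rotAvg]

lemma norm_rotAvg_le (ν : Measure (OmegaL d m L)) [IsProbabilityMeasure ν] (N : ℕ)
    (u : C(Td d, 𝕜)) : ‖rotAvg 𝕜 ν N u‖ ≤ ‖u‖ := by
  rw [rotAvg_apply, norm_smul, norm_inv, RCLike.norm_natCast]
  have h : ‖∑ j ∈ Finset.range N, (rotOp 𝕜 ν ^ j) u‖ ≤ N * ‖u‖ := by
    refine (norm_sum_le_of_le _ fun j _ => norm_rotOp_pow_le ν j u).trans ?_
    simp
  rcases N.eq_zero_or_pos with rfl | hN
  · simp
  · rwa [inv_mul_le_iff₀ (by positivity)]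

lemma norm_integral_torus_le (u : C(Td d, 𝕜)) : ‖∫ θ, u θ‖ ≤ ‖u‖ := by
  refine (norm_integral_le_of_norm_le_const (ae_of_all _ u.norm_coe_le_norm)).trans ?_
  simp

lemma integrable_torus (u : C(Td d, 𝕜)) : Integrable (fun θ => u θ) (volume : Measure (Td d)) :=
  Integrable.of_bound (aestronglyMeasurable_of_continuous u.continuous) ‖u‖
    (ae_of_all _ fun a => ContinuousMap.norm_coe_le_norm u a)

/-- A character of the torus. -/
structure IsChar (v : C(Td d, ℂ)) : Prop where
  map_add : ∀ x y, v (x + y) = v x * v y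
  norm_eq : ∀ x, ‖v x‖ = 1

lemma isChar_mFourier (k : Fin d → ℤ) : IsChar (UnitAddTorus.mFourier k : C(Td d, ℂ)) where
  map_add x y := by
    simp only [UnitAddTorus.mFourier, ContinuousMap.coe_mk, ← Finset.prod_mul_distrib,
      fourier_apply, Pi.add_apply, smul_add, AddCircle.toCircle_add, Circle.coe_mul]
  norm_eq x := by
    simp only [UnitAddTorus.mFourier, ContinuousMap.coe_mk, norm_prod, fourier_apply,
      Circle.norm_coe, Finset.prod_const_one]

variable {ν : Measure (OmegaL d m L)} [IsProbabilityMeasure ν]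

lemma IsChar.rotOp_pow {v : C(Td d, ℂ)} (hv : IsChar v) (n : ℕ) :
    (rotOp ℂ ν ^ n) v = (∫ a, v (freq a) ∂ν) ^ n • v := by
  induction n with
  | zero => simp
  | succ n ih =>
    rw [pow_succ', Module.End.mul_apply, ih, map_smul]
    have : rotOp ℂ ν v = (∫ a, v (freq a) ∂ν) • v := by
      ext θ
      simp [rotOp_apply, hv.map_add, integral_const_mul, mul_comm]
    rw [this, smul_smul, pow_succ]

lemma integrable_freq (v : C(Td d, 𝕜)) : Integrable (fun a => v (freq a)) ν :=
  Integrable.of_bound (aestronglyMeasurable_of_continuous (v.continuous.comp continuous_freq)) ‖v‖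
    (ae_of_all _ fun _ => ContinuousMap.norm_coe_le_norm v _)

lemma IsChar.ae_eq_one {v : C(Td d, ℂ)} (hv : IsChar v) (h : ∫ a, v (freq a) ∂ν = 1) :
    ∀ᵐ a ∂ν, v (freq a) = 1 := by
  have hre : ∫ a, (v (freq a)).re ∂ν = 1 := by
    have := Complex.reCLM.integral_comp_comm (integrable_freq (ν := ν) v)
    simpa [h] using this
  have hle : ∀ a : OmegaL d m L, (v (freq a)).re ≤ 1 := fun a =>
    (Complex.re_le_norm _).trans (hv.norm_eq _).le
  have hi : Integrable (fun a => (v (freq a)).re) ν :=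
    Complex.reCLM.integrable_comp (integrable_freq (ν := ν) v)
  have h0 : ∫ a, (1 - (v (freq a)).re) ∂ν = 0 := by
    rw [integral_sub (integrable_const _) hi, hre]; simp
  have hi' : Integrable (fun a => 1 - (v (freq a)).re) ν := (integrable_const _).sub hi
  rw [integral_eq_zero_iff_of_nonneg (fun a => by simpa using hle a) hi'] at h0
  filter_upwards [h0] with a ha
  have h1 : (v (freq a)).re = 1 := by simp only [Pi.zero_apply] at ha; linarith
  have h2 : Complex.normSq (v (freq a)) = 1 := by
    rw [Complex.normSq_eq_norm_sq, hv.norm_eq, one_pow]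
  rw [Complex.normSq_apply, h1] at h2
  apply Complex.ext
  · simpa using h1
  · simp only [Complex.one_im]; nlinarith

lemma IsChar.eq_const_of_ergodic {P : Measure (ℤ → OmegaL d m L)} (hP : IsBernoulli ν P)
    (herg : Ergodic baseMap (P.prod (volume : Measure (Td d)))) {v : C(Td d, ℂ)}
    (hv : IsChar v) (h : ∫ a, v (freq a) ∂ν = 1) :
    ∃ c, v = ContinuousMap.const _ c := by
  have := hP.1
  have h1 : ∀ᵐ ω ∂P, v (freq (ω 0)) = 1 := by
    have := hv.ae_eq_one h
    rw [← map_eval_of_isBernoulli hP 0] at this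
    exact ae_of_ae_map (measurable_pi_apply _).aemeasurable this
  have h2 : (fun p : (ℤ → OmegaL d m L) × Td d => v p.2) ∘ baseMap
      =ᵐ[P.prod (volume : Measure (Td d))] fun p => v p.2 := by
    filter_upwards [Measure.quasiMeasurePreserving_fst.ae h1] with p hp
    change v (p.2 + freq (p.1 0)) = v p.2
    rw [hv.map_add, hp, mul_one]
  obtain ⟨c, hc⟩ := herg.ae_eq_const_of_ae_eq_comp_ae (aestronglyMeasurable_of_continuous
    (v.continuous.comp continuous_snd)) h2
  obtain ⟨ω, hω⟩ := (Measure.ae_ae_of_ae_prod hc).exists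
  refine ⟨c, ContinuousMap.coe_injective ?_⟩
  exact (v.continuous.ae_eq_iff_eq volume (ContinuousMap.const _ c).continuous).1 hω

lemma IsChar.integral_eq_zero {v : C(Td d, ℂ)} (hv : IsChar v) {x : Td d} (hx : v x ≠ 1) :
    ∫ θ, v θ = 0 := by
  have h := integral_add_right_eq_self (μ := (volume : Measure (Td d))) v x
  simp only [hv.map_add, integral_mul_const] at h
  have : (∫ θ, v θ) * (v x - 1) = 0 := by rw [mul_sub, h]; ring
  exact (mul_eq_zero.1 this).resolve_right (sub_ne_zero.2 hx)

lemma tendsto_average_pow {z : ℂ} (hz : ‖z‖ ≤ 1) (hz1 : z ≠ 1) :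
    Tendsto (fun N : ℕ => (N : ℂ)⁻¹ * ∑ j ∈ Finset.range N, z ^ j) atTop (𝓝 0) := by
  have hlim : Tendsto (fun N : ℕ => (N : ℝ)⁻¹ * (2 / ‖z - 1‖)) atTop (𝓝 0) := by
    simpa using (tendsto_inv_atTop_nhds_zero_nat (𝕜 := ℝ)).mul_const (2 / ‖z - 1‖)
  refine squeeze_zero_norm (fun N => ?_) hlim
  rw [geom_sum_eq hz1, norm_mul, norm_inv, Complex.norm_natCast, norm_div]
  gcongr
  refine (norm_sub_le _ _).trans ?_
  rw [norm_pow, norm_one]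
  linarith [pow_le_one₀ (n := N) (norm_nonneg z) hz]

lemma IsChar.tendsto_rotAvg {P : Measure (ℤ → OmegaL d m L)} (hP : IsBernoulli ν P)
    (herg : Ergodic baseMap (P.prod (volume : Measure (Td d)))) {v : C(Td d, ℂ)}
    (hv : IsChar v) :
    Tendsto (fun N => rotAvg ℂ ν N v) atTop (𝓝 (ContinuousMap.const _ (∫ θ, v θ))) := by
  have hA : ∀ N, rotAvg ℂ ν N v =
      ((N : ℂ)⁻¹ * ∑ j ∈ Finset.range N, (∫ a, v (freq a) ∂ν) ^ j) • v := fun N => by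
    simp only [rotAvg_apply, hv.rotOp_pow, ← Finset.sum_smul, smul_smul]
  simp only [hA]
  by_cases h : ∫ a, v (freq a) ∂ν = 1
  · obtain ⟨c, rfl⟩ := hv.eq_const_of_ergodic hP herg h
    rw [h]
    simp only [one_pow, Finset.sum_const, Finset.card_range, nsmul_eq_mul, mul_one,
      ContinuousMap.const_apply, integral_const, probReal_univ, one_smul]
    refine tendsto_const_nhds.congr' ?_
    filter_upwards [eventually_ne_atTop 0] with N hN
    rw [inv_mul_cancel₀ (by exact_mod_cast hN), one_smul]
  · have hne : ∃ a : OmegaL d m L, v (freq a) ≠ 1 := by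
      by_contra! hall
      simp [hall] at h
    obtain ⟨a, ha⟩ := hne
    rw [hv.integral_eq_zero ha]
    have hle : ‖∫ a, v (freq a) ∂ν‖ ≤ 1 := by
      refine (norm_integral_le_of_norm_le_const (ae_of_all _ fun a =>
        (hv.norm_eq (freq a)).le)).trans ?_
      simp
    have := (tendsto_average_pow hle h).smul_const v
    convert this using 2
    ext
    simp

/-- Uniform convergence of the averages of the random rotation operator, under ergodicity. -/
lemma tendsto_rotAvg {P : Measure (ℤ → OmegaL d m L)} (hP : IsBernoulli ν P)
    (herg : Ergodic baseMap (P.prod (volume : Measure (Td d)))) (u : C(Td d, ℂ)) :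
    Tendsto (fun N => rotAvg ℂ ν N u) atTop (𝓝 (ContinuousMap.const _ (∫ θ, u θ))) := by
  have hspan : ∀ p ∈ Submodule.span ℂ
      (Set.range (UnitAddTorus.mFourier : (Fin d → ℤ) → C(Td d, ℂ))),
      Tendsto (fun N => rotAvg ℂ ν N p) atTop (𝓝 (ContinuousMap.const _ (∫ θ, p θ))) := by
    intro p hp
    induction hp using Submodule.span_induction with
    | mem x hx =>
      obtain ⟨k, rfl⟩ := hx
      exact (isChar_mFourier k).tendsto_rotAvg hP herg
    | zero =>
      have : ContinuousMap.const (Td d) (∫ θ : Td d, (0 : C(Td d, ℂ)) θ) = 0 := by ext; simp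
      rw [this]
      simp
    | add x y _ _ hx hy =>
      have : ContinuousMap.const (Td d) (∫ θ : Td d, (x + y) θ) =
          ContinuousMap.const _ (∫ θ, x θ) + ContinuousMap.const _ (∫ θ, y θ) := by
        ext
        simp [integral_add (integrable_torus x) (integrable_torus y)]
      rw [this]
      simpa using hx.add hy
    | smul c x _ hx =>
      have : ContinuousMap.const (Td d) (∫ θ : Td d, (c • x) θ) =
          c • ContinuousMap.const _ (∫ θ, x θ) := by
        ext
        simp [integral_const_mul]
      rw [this]
      simpa using hx.const_smul c
  have hdense : u ∈ closure (Submodule.span ℂ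
      (Set.range (UnitAddTorus.mFourier : (Fin d → ℤ) → C(Td d, ℂ))) : Set C(Td d, ℂ)) := by
    rw [← Submodule.topologicalClosure_coe, UnitAddTorus.span_mFourier_closure_eq_top]
    trivial
  rw [Metric.tendsto_atTop]
  intro ε hε
  obtain ⟨p, hp, hup⟩ := Metric.mem_closure_iff.1 hdense (ε / 3) (by positivity)
  obtain ⟨N₀, hN₀⟩ := Metric.tendsto_atTop.1 (hspan p hp) (ε / 3) (by positivity)
  refine ⟨N₀, fun N hN => ?_⟩
  have h1 : dist (rotAvg ℂ ν N u) (rotAvg ℂ ν N p) < ε / 3 := by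
    rw [dist_eq_norm, ← map_sub]
    exact (norm_rotAvg_le ν N _).trans_lt (by rwa [← dist_eq_norm])
  have h2 : dist (ContinuousMap.const (Td d) (∫ θ, p θ)) (ContinuousMap.const _ (∫ θ, u θ))
      < ε / 3 := by
    refine lt_of_le_of_lt ?_ hup
    rw [ContinuousMap.dist_le dist_nonneg]
    intro θ
    rw [ContinuousMap.const_apply, ContinuousMap.const_apply, dist_eq_norm,
      ← integral_sub (integrable_torus p) (integrable_torus u), dist_comm, dist_eq_norm]
    exact norm_integral_torus_le (p - u)
  calc dist (rotAvg ℂ ν N u) (ContinuousMap.const _ (∫ θ, u θ))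
      ≤ dist (rotAvg ℂ ν N u) (rotAvg ℂ ν N p)
        + dist (rotAvg ℂ ν N p) (ContinuousMap.const _ (∫ θ, p θ))
        + dist (ContinuousMap.const (Td d) (∫ θ, p θ)) (ContinuousMap.const _ (∫ θ, u θ)) :=
        dist_triangle4 _ _ _ _
    _ < ε / 3 + ε / 3 + ε / 3 := by gcongr; exact hN₀ N hN
    _ = ε := by ring

lemma rotOp_pow_ofReal (n : ℕ) (u : C(Td d, ℝ)) (θ : Td d) :
    (rotOp ℂ ν ^ n) ((⟨Complex.ofReal, Complex.continuous_ofReal⟩ : C(ℝ, ℂ)).comp u) θ =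
      ((rotOp ℝ ν ^ n) u θ : ℂ) := by
  induction n generalizing θ with
  | zero => rfl
  | succ n ih =>
    rw [pow_succ', pow_succ', Module.End.mul_apply, Module.End.mul_apply, rotOp_apply,
      rotOp_apply]
    simp only [ih]
    exact integral_ofReal

lemma exists_sum_rotOp_le {P : Measure (ℤ → OmegaL d m L)} (hP : IsBernoulli ν P)
    (herg : Ergodic baseMap (P.prod (volume : Measure (Td d)))) (u : C(Td d, ℝ)) {η : ℝ}
    (hη : 0 < η) :
    ∃ N₀ : ℕ, ∀ N ≥ N₀, ∀ θ,
      ∑ j ∈ Finset.range N, (rotOp ℝ ν ^ j) u θ ≤ N * ((∫ θ, u θ) + η) := by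
  let w : C(Td d, ℂ) := (⟨Complex.ofReal, Complex.continuous_ofReal⟩ : C(ℝ, ℂ)).comp u
  have hw_int : ∫ θ, w θ = ((∫ θ, u θ : ℝ) : ℂ) := integral_ofReal
  obtain ⟨N₀, hN₀⟩ := Metric.tendsto_atTop.1 (tendsto_rotAvg hP herg w) η hη
  refine ⟨N₀, fun N hN θ => ?_⟩
  rcases N.eq_zero_or_pos with rfl | hpos
  · simp
  have h := (ContinuousMap.dist_apply_le_dist θ).trans_lt (hN₀ N hN)
  have hw : rotAvg ℂ ν N w θ =
      (((N : ℝ)⁻¹ * ∑ j ∈ Finset.range N, (rotOp ℝ ν ^ j) u θ : ℝ) : ℂ) := by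
    rw [rotAvg_apply]
    simp [w, rotOp_pow_ofReal]
  rw [hw, ContinuousMap.const_apply, hw_int, Complex.isometry_ofReal.dist_eq,
    Real.dist_eq] at h
  have h' := (abs_lt.1 h).2.le
  rwa [sub_le_iff_le_add', inv_mul_le_iff₀ (by positivity)] at h'

end Rotation

section LogNorm

/-- The observable `(θ, M) ↦ log⁺ ‖M‖`. -/
def logNorm (d m : ℕ) : C(St d m, ℝ) :=
  ⟨fun s => Real.posLog ‖s.2‖, Real.continuous_posLog.comp (by fun_prop)⟩

lemma logNorm_apply (s : St d m) : logNorm d m s = Real.posLog ‖s.2‖ := rfl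

lemma logNorm_nonneg (s : St d m) : 0 ≤ logNorm d m s := Real.posLog_nonneg

lemma logNorm_mul_le (θ : Td d) (M M' : EndE m) :
    logNorm d m (θ, M * M') ≤ logNorm d m (θ, M) + Real.posLog ‖M'‖ :=
  (Real.posLog_le_posLog (norm_nonneg _) (norm_mul_le M M')).trans Real.posLog_mul

/-- The observable `(θ, M) ↦ max(‖M‖, 1)^t`. -/
def expNorm (d m : ℕ) (t : ℝ) : C(St d m, ℝ) :=
  ⟨fun s => Real.exp (t * logNorm d m s), by fun_prop⟩

lemma expNorm_apply (t : ℝ) (s : St d m) : expNorm d m t s = Real.exp (t * logNorm d m s) := rfl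

/-- Right multiplication by a fixed endomorphism on the state space. -/
def rmul (d : ℕ) {m : ℕ} (M' : EndE m) : C(St d m, St d m) :=
  ⟨fun s => (s.1, s.2 * M'), by fun_prop⟩

variable (ν : Measure (OmegaL d m L)) [IsProbabilityMeasure ν]

lemma stepOp_pow_comp_rmul (n : ℕ) (G : C(St d m, ℝ)) (M' : EndE m) (s : St d m) :
    (stepOp ℝ ν ^ n) (G.comp (rmul d M')) s = (stepOp ℝ ν ^ n) G (s.1, s.2 * M') := by
  induction n generalizing s with
  | zero => rfl
  | succ n ih =>
    rw [pow_succ', Module.End.mul_apply, Module.End.mul_apply, stepOp_apply, stepOp_apply]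
    simp only [ih, step, mul_assoc]

lemma stepOp_pow_const (n : ℕ) (c : ℝ) (s : St d m) :
    (stepOp ℝ ν ^ n) (ContinuousMap.const _ c) s = c := by
  induction n generalizing s with
  | zero => rfl
  | succ n ih =>
    rw [pow_succ', Module.End.mul_apply, stepOp_apply]
    simp [ih]

lemma stepOp_pow_logNorm_le (n : ℕ) (s : St d m) :
    (stepOp ℝ ν ^ n) (logNorm d m) s ≤ (stepOp ℝ ν ^ n) (logNorm d m) (s.1, 1) + logNorm d m s := by
  have h := stepOp_pow_comp_rmul ν n (logNorm d m) s.2 (s.1, 1)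
  rw [one_mul] at h
  have h2 := stepOp_pow_mono ν n (G := (logNorm d m).comp (rmul d s.2))
    (H := logNorm d m + ContinuousMap.const _ (logNorm d m s))
    (fun s' => logNorm_mul_le s'.1 s'.2 s.2) (s.1, 1)
  rw [map_add, ContinuousMap.add_apply, stepOp_pow_const, h] at h2
  exact h2

lemma stepOp_pow_expNorm_le {t : ℝ} (ht : 0 ≤ t) (n : ℕ) (s : St d m) :
    (stepOp ℝ ν ^ n) (expNorm d m t) s ≤
      (stepOp ℝ ν ^ n) (expNorm d m t) (s.1, 1) * expNorm d m t s := by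
  have h := stepOp_pow_comp_rmul ν n (expNorm d m t) s.2 (s.1, 1)
  rw [one_mul] at h
  have h2 := stepOp_pow_mono ν n (G := (expNorm d m t).comp (rmul d s.2))
    (H := expNorm d m t s • expNorm d m t) (fun s' => by
      rw [ContinuousMap.smul_apply, smul_eq_mul, expNorm_apply, expNorm_apply, ← Real.exp_add]
      refine Real.exp_le_exp.2 ?_
      have := mul_le_mul_of_nonneg_left (logNorm_mul_le s'.1 s'.2 s.2) ht
      change t * logNorm d m (s'.1, s'.2 * s.2) ≤
        t * Real.posLog ‖s.2‖ + t * logNorm d m (s'.1, s'.2)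
      linarith) (s.1, 1)
  rw [map_smul, ContinuousMap.smul_apply, smul_eq_mul, h, mul_comm] at h2
  exact h2

/-- The expected logarithmic growth of the fiber norms after `n` steps. -/
def growth (n : ℕ) : C(Td d, ℝ) :=
  ((stepOp ℝ ν ^ n) (logNorm d m)).comp ⟨fun θ => (θ, 1), by fun_prop⟩

lemma growth_apply (n : ℕ) (θ : Td d) :
    growth ν n θ = (stepOp ℝ ν ^ n) (logNorm d m) (θ, 1) := rfl

lemma growth_add_le (n k : ℕ) (θ : Td d) :
    growth ν (n + k) θ ≤ (rotOp ℝ ν ^ n) (growth ν k) θ + growth ν n θ := by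
  rw [growth_apply, pow_add, Module.End.mul_apply]
  refine (stepOp_pow_mono ν n (H := (growth ν k).comp ⟨Prod.fst, continuous_fst⟩ + logNorm d m)
    (fun s => stepOp_pow_logNorm_le ν k s) _).trans ?_
  rw [map_add, ContinuousMap.add_apply, stepOp_pow_comp_fst]
  rfl

lemma growth_nonneg (n : ℕ) (θ : Td d) : 0 ≤ growth ν n θ := by
  have := stepOp_pow_mono ν n (G := ContinuousMap.const _ 0) (H := logNorm d m)
    logNorm_nonneg (θ, 1)
  rwa [stepOp_pow_const] at this

variable {ν} {P : Measure (ℤ → OmegaL d m L)}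

lemma integral_logNorm_orb (hP : IsBernoulli ν P) (θ : Td d) (n : ℕ) :
    ∫ ω, logNorm d m (orb θ ω n) ∂P = growth ν n θ :=
  integral_orb hP θ n _

lemma growth_le (hP : IsBernoulli ν P) (n : ℕ) (θ : Td d) :
    growth ν n θ ≤ n * Real.posLog L := by
  have := hP.1
  rw [← integral_logNorm_orb hP]
  refine (integral_mono (integrable_orb P (logNorm d m) θ n) (integrable_const (n * Real.posLog L))
    fun ω => norm_orb_le θ ω n).trans ?_
  simp

/-- Upgrade of a bound on the mean growth to a uniform one, using uniform convergence of
averages under the random rotation. -/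
lemma exists_growth_le (hP : IsBernoulli ν P)
    (herg : Ergodic baseMap (P.prod (volume : Measure (Td d)))) {l : ℝ}
    {n₀ : ℕ} (hn₀ : 0 < n₀) (hl : ∫ θ, growth ν n₀ θ ≤ n₀ * l) {η : ℝ} (hη : 0 < η) :
    ∃ n : ℕ, 0 < n ∧ ∀ θ, growth ν n θ ≤ n * (l + η) := by
  have hC : 0 ≤ Real.posLog L := Real.posLog_nonneg
  have hn₀' : (0 : ℝ) < n₀ := by exact_mod_cast hn₀
  have hl0 : 0 ≤ l := by
    have : 0 ≤ ∫ θ, growth ν n₀ θ := integral_nonneg (growth_nonneg ν n₀)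
    exact nonneg_of_mul_nonneg_right (this.trans hl) hn₀'
  obtain ⟨N₀, hN₀⟩ := exists_sum_rotOp_le hP herg (growth ν n₀) (half_pos hη)
  obtain ⟨N₁, hN₁⟩ := exists_nat_ge (4 * n₀ ^ 2 * Real.posLog L / η)
  set N := max N₀ N₁
  refine ⟨N + n₀, by omega, fun θ => ?_⟩
  have hN : 4 * n₀ ^ 2 * Real.posLog L ≤ N * η := by
    rw [div_le_iff₀ hη] at hN₁
    refine hN₁.trans ?_
    gcongr
    exact le_max_right _ _
  have hS := hN₀ N (le_max_left _ _) θ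
  set S := ∑ j ∈ Finset.range N, (rotOp ℝ ν ^ j) (growth ν n₀) θ
  have h1 : ∑ j ∈ Finset.range N, growth ν (n₀ + j) θ ≤
      S + ∑ j ∈ Finset.range N, growth ν j θ := by
    rw [← Finset.sum_add_distrib]
    refine Finset.sum_le_sum fun j _ => ?_
    rw [add_comm]
    exact growth_add_le ν j n₀ θ
  have h2 := Finset.sum_range_add (fun j => growth ν j θ) n₀ N
  have h3 := Finset.sum_range_add (fun j => growth ν j θ) N n₀
  rw [add_comm n₀ N, h3] at h2
  have h4 : ∑ j ∈ Finset.range n₀, growth ν j θ ≤ n₀ * (n₀ * Real.posLog L) := by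
    refine (Finset.sum_le_card_nsmul _ _ (n₀ * Real.posLog L) fun j hj => ?_).trans (by simp)
    refine (growth_le hP j θ).trans ?_
    gcongr
    exact (Finset.mem_range.1 hj).le
  have h5 : n₀ * (growth ν (N + n₀) θ - n₀ * Real.posLog L) ≤
      ∑ j ∈ Finset.range n₀, growth ν (N + j) θ := by
    have := Finset.card_nsmul_le_sum (Finset.range n₀) (fun j => growth ν (N + j) θ)
      (growth ν (N + n₀) θ - n₀ * Real.posLog L) fun j hj => ?_
    · simpa using this
    · have hj' := (Finset.mem_range.1 hj).le
      have e := growth_add_le ν (N + j) (n₀ - j) θ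
      rw [show N + j + (n₀ - j) = N + n₀ by omega] at e
      have e2 : (rotOp ℝ ν ^ (N + j)) (growth ν (n₀ - j)) θ ≤ n₀ * Real.posLog L := by
        refine (le_abs_self _).trans ((ContinuousMap.norm_coe_le_norm
          ((rotOp ℝ ν ^ (N + j)) (growth ν (n₀ - j))) θ).trans
          ((norm_rotOp_pow_le ν _ _).trans ?_))
        rw [ContinuousMap.norm_le _ (by positivity)]
        intro x
        rw [Real.norm_of_nonneg (growth_nonneg ν _ x)]
        refine (growth_le hP _ x).trans ?_
        gcongr
        omega
      linarith
  have h6 : N * ((∫ θ, growth ν n₀ θ) + η / 2) ≤ N * (n₀ * l + η / 2) := by gcongr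
  push_cast
  refine le_of_mul_le_mul_left ?_ hn₀'
  have h7 : 0 ≤ (n₀ : ℝ) * n₀ * (l + η) := by positivity
  have h8 : (N : ℝ) * η ≤ n₀ * (N * η) :=
    le_mul_of_one_le_left (by positivity) (by exact_mod_cast hn₀)
  nlinarith

lemma det_cocycleIter (ω : ℤ → OmegaL d m L) (n : ℕ) (θ : Td d) : (cocycleIter ω n θ).det = 1 := by
  induction n with
  | zero => simp [cocycleIter]
  | succ n ih => rw [cocycleIter, Matrix.det_mul, ih, Matrix.SpecialLinearGroup.det_coe, one_mul]

lemma one_le_matOpNorm (hm : m ≠ 0) {A : Matrix (Fin m) (Fin m) ℝ} (hA : A.det = 1) :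
    1 ≤ matOpNorm A := by
  by_contra! h
  rw [← norm_clm] at h
  have : Nonempty (Fin m) := ⟨⟨0, Nat.pos_of_ne_zero hm⟩⟩
  have hdet : (clm A).det = 1 := by
    change LinearMap.det (Matrix.toLpLin 2 2 A) = 1
    rw [Matrix.toLpLin_eq_toLin, LinearMap.det_toLin, hA]
  have hpow : ∀ k : ℕ, (clm A ^ k).det = 1 := fun k => by
    induction k with
    | zero => exact LinearMap.det_id
    | succ k ih =>
      rw [pow_succ]
      exact (LinearMap.det_comp _ _).trans ((congrArg₂ (· * ·) ih hdet).trans (one_mul 1))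
  have hlim := (ContinuousLinearMap.continuous_det.tendsto 0).comp
    (tendsto_pow_atTop_nhds_zero_of_norm_lt_one h)
  have h0 : (0 : EndE m).det = 0 := LinearMap.det_zero' (PiLp.basisFun 2 ℝ (Fin m))
  rw [h0] at hlim
  have := tendsto_nhds_unique hlim (tendsto_const_nhds.congr fun k => (hpow k).symm)
  exact zero_ne_one this

lemma log_matOpNorm {A : Matrix (Fin m) (Fin m) ℝ} (hA : A.det = 1) :
    Real.log (matOpNorm A) = Real.posLog (matOpNorm A) := by
  rcases eq_or_ne m 0 with rfl | hm
  · have : matOpNorm A = 0 := by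
      rw [← norm_clm, norm_eq_zero]
      exact Subsingleton.elim _ _
    simp [this]
  · have h := one_le_matOpNorm hm hA
    exact (Real.posLog_eq_log (by rwa [abs_of_nonneg (by linarith)])).symm

lemma log_matOpNorm_cocycleIter (ω : ℤ → OmegaL d m L) (n : ℕ) (θ : Td d) :
    Real.log (matOpNorm (cocycleIter ω n θ)) = logNorm d m (orb θ ω n) := by
  rw [log_matOpNorm (det_cocycleIter ω n θ), logNorm_apply, orb_eq, norm_clm]

lemma integral_log_cocycleIter (hP : IsBernoulli ν P) (n : ℕ) :
    ∫ p, Real.log (matOpNorm (cocycleIter p.1 n p.2)) ∂(P.prod (volume : Measure (Td d))) =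
      ∫ θ, growth ν n θ := by
  have := hP.1
  simp only [log_matOpNorm_cocycleIter]
  have hi : Integrable (fun p : (ℤ → OmegaL d m L) × Td d => logNorm d m (orb p.2 p.1 n))
      (P.prod (volume : Measure (Td d))) := by
    refine Integrable.of_bound (aestronglyMeasurable_of_continuous
      ((logNorm d m).continuous.comp (continuous_orb n))) (n * Real.posLog L)
      (ae_of_all _ fun p => ?_)
    rw [Real.norm_of_nonneg (logNorm_nonneg _)]
    exact norm_orb_le p.2 p.1 n
  rw [integral_prod_symm _ hi]
  simp only [integral_logNorm_orb hP]

/-- A bound on the mean growth after `n` steps yields a bound on small exponential moments. -/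
lemma expNorm_le (hP : IsBernoulli ν P) {n : ℕ} {θ : Td d} {b t : ℝ} (ht : 0 ≤ t)
    (hb : growth ν n θ ≤ b) (h1 : t * (n * Real.posLog L) ≤ 1) :
    (stepOp ℝ ν ^ n) (expNorm d m t) (θ, 1) ≤
      Real.exp (t * b + (t * (n * Real.posLog L)) ^ 2) := by
  have := hP.1
  rw [← integral_orb hP]
  set K := t * (n * Real.posLog L)
  have hpt : ∀ ω : ℤ → OmegaL d m L, expNorm d m t (orb θ ω n) ≤
      1 + K ^ 2 + t * logNorm d m (orb θ ω n) := by
    intro ω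
    rw [expNorm_apply]
    have e0 : 0 ≤ t * logNorm d m (orb θ ω n) := mul_nonneg ht (logNorm_nonneg _)
    have e1 : t * logNorm d m (orb θ ω n) ≤ K := mul_le_mul_of_nonneg_left (norm_orb_le θ ω n) ht
    have e2 := Real.abs_exp_sub_one_sub_id_le (x := t * logNorm d m (orb θ ω n))
      (by rw [abs_of_nonneg e0]; linarith)
    have e3 := (abs_le.1 e2).2
    nlinarith
  have hi := integrable_orb P (logNorm d m) θ n
  have h2 := integral_mono (integrable_orb P (expNorm d m t) θ n)
    ((integrable_const (1 + K ^ 2)).add (hi.const_mul t)) hpt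
  simp only [Pi.add_apply] at h2
  rw [integral_add (integrable_const _) (hi.const_mul t), integral_const_mul,
    integral_logNorm_orb hP, integral_const, probReal_univ, one_smul] at h2
  have h3 := Real.add_one_le_exp (t * b + K ^ 2)
  have h4 := mul_le_mul_of_nonneg_left hb ht
  linarith

lemma expNorm_mul_le {n : ℕ} {t κ : ℝ} (ht : 0 ≤ t)
    (hκ : ∀ θ, (stepOp ℝ ν ^ n) (expNorm d m t) (θ, 1) ≤ κ) (k : ℕ) (s : St d m) :
    (stepOp ℝ ν ^ (k * n)) (expNorm d m t) s ≤ κ ^ k * expNorm d m t s := by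
  have h0 : ∀ s, 0 ≤ expNorm d m t s := fun s => (Real.exp_pos _).le
  have hκ0 : 0 ≤ κ := by
    refine le_trans ?_ (hκ 0)
    have := stepOp_pow_mono ν n (G := ContinuousMap.const _ 0) (H := expNorm d m t) h0 (0, 1)
    rwa [stepOp_pow_const] at this
  induction k generalizing s with
  | zero => simp
  | succ k ih =>
    rw [add_mul, one_mul, pow_add, Module.End.mul_apply]
    refine (stepOp_pow_mono ν (k * n) (H := κ • expNorm d m t) (fun s => ?_) s).trans ?_
    · exact (stepOp_pow_expNorm_le ν ht n s).trans (mul_le_mul_of_nonneg_right (hκ s.1) (h0 s))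
    · rw [map_smul, ContinuousMap.smul_apply, smul_eq_mul, pow_succ', mul_assoc]
      exact mul_le_mul_of_nonneg_left (ih s) hκ0

lemma expNorm_le_of_block (hP : IsBernoulli ν P) {n₁ : ℕ} (hn₁ : 0 < n₁) {t b : ℝ} (ht : 0 ≤ t)
    (hb : 0 ≤ b)
    (hκ : ∀ θ, (stepOp ℝ ν ^ n₁) (expNorm d m t) (θ, 1) ≤ Real.exp (t * (n₁ * b))) (n : ℕ)
    (θ : Td d) :
    (stepOp ℝ ν ^ n) (expNorm d m t) (θ, 1) ≤
      Real.exp (t * (n * b) + t * (n₁ * Real.posLog L)) := by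
  have := hP.1
  have hC : 0 ≤ Real.posLog L := Real.posLog_nonneg
  have hn : n = n % n₁ + n / n₁ * n₁ := by rw [mul_comm, Nat.mod_add_div]
  have hr : ((n % n₁ : ℕ) : ℝ) ≤ n₁ := by exact_mod_cast (Nat.mod_lt n hn₁).le
  have hk : ((n / n₁ : ℕ) : ℝ) * n₁ ≤ n := by exact_mod_cast Nat.div_mul_le_self n n₁
  set r := n % n₁
  set k := n / n₁
  have h1 : (stepOp ℝ ν ^ n) (expNorm d m t) (θ, 1) ≤
      Real.exp (t * (n₁ * b)) ^ k * (stepOp ℝ ν ^ r) (expNorm d m t) (θ, 1) := by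
    rw [hn, pow_add, Module.End.mul_apply]
    refine (stepOp_pow_mono ν r (H := Real.exp (t * (n₁ * b)) ^ k • expNorm d m t)
      (fun s => expNorm_mul_le ht hκ k s) _).trans_eq ?_
    rw [map_smul]
    rfl
  have h2 : (stepOp ℝ ν ^ r) (expNorm d m t) (θ, 1) ≤ Real.exp (t * (n₁ * Real.posLog L)) := by
    rw [← integral_orb hP]
    refine (integral_mono (integrable_orb P (expNorm d m t) θ r)
      (integrable_const (Real.exp (t * (n₁ * Real.posLog L)))) fun ω => ?_).trans (by simp)
    rw [expNorm_apply]
    refine Real.exp_le_exp.2 (mul_le_mul_of_nonneg_left ((norm_orb_le θ ω r).trans ?_) ht)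
    gcongr
  refine h1.trans ((mul_le_mul_of_nonneg_left h2 (by positivity)).trans ?_)
  rw [← Real.exp_nat_mul, ← Real.exp_add, Real.exp_le_exp]
  have h3 := mul_le_mul_of_nonneg_left (mul_le_mul_of_nonneg_right hk hb) ht
  nlinarith

/-- Chernoff bound for the growth of the fiber norms. -/
lemma measure_le_logNorm_orb_le (hP : IsBernoulli ν P) {t x y : ℝ} (ht : 0 ≤ t) {n : ℕ} {θ : Td d}
    (h : (stepOp ℝ ν ^ n) (expNorm d m t) (θ, 1) ≤ Real.exp y) :
    P {ω | x ≤ logNorm d m (orb θ ω n)} ≤ ENNReal.ofReal (Real.exp (y - t * x)) := by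
  have := hP.1
  have h1 := mul_meas_ge_le_integral_of_nonneg (μ := P)
    (f := fun ω => expNorm d m t (orb θ ω n)) (ae_of_all _ fun ω => (Real.exp_pos _).le)
    (integrable_orb P (expNorm d m t) θ n) (Real.exp (t * x))
  rw [integral_orb hP] at h1
  have hsub : {ω : ℤ → OmegaL d m L | x ≤ logNorm d m (orb θ ω n)} ⊆
      {ω | Real.exp (t * x) ≤ expNorm d m t (orb θ ω n)} := fun ω hω =>
    Real.exp_le_exp.2 (mul_le_mul_of_nonneg_left hω ht)
  refine (measure_mono hsub).trans ?_
  rw [ENNReal.le_ofReal_iff_toReal_le (measure_ne_top _ _) (Real.exp_pos _).le, Real.exp_sub,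
    le_div_iff₀ (Real.exp_pos _), mul_comm]
  exact h1.trans h

end LogNorm

end QPCocycle

/-- (Uniform upper large deviations for the fiber dynamics.)
Let `ν₀` be a compactly supported Borel probability measure on `Ω = 𝒢_L` whose
base dynamics is ergodic, with maximal Lyapunov exponent `L₁(ν₀) = ℓ₀`. Then
for every `ε > 0` there are `δ > 0`, `N` and `c > 0` such that for every
compactly supported Borel probability measure `ν` on `Ω` with `W₁(ν, ν₀) < δ`,
every `θ ∈ 𝕋^d` and every `n ≥ N`,
`ν^ℤ {ω : (1/n) log‖𝒜ⁿ(ω)(θ)‖ ≥ ℓ₀ + ε} < e^{-cn}`. -/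
theorem fiber_upper_large_deviations {d m : ℕ} {L : ℝ}
    (ν₀ : Measure (OmegaL d m L)) [IsProbabilityMeasure ν₀]
    (hν₀ : ∃ K : Set (OmegaL d m L), IsCompact K ∧ ν₀ Kᶜ = 0)
    (ν₀Z : Measure (ℤ → OmegaL d m L)) (hν₀Z : IsBernoulli ν₀ ν₀Z)
    (herg : Ergodic baseMap (ν₀Z.prod volume))
    (ℓ₀ : ℝ)
    (hℓ₀ : Tendsto (fun n : ℕ =>
        (1 / (n : ℝ)) * ∫ p, Real.log (matOpNorm (cocycleIter p.1 n p.2))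
          ∂(ν₀Z.prod (volume : Measure (Td d))))
      atTop (𝓝 ℓ₀)) :
    ∀ ε > (0:ℝ), ∃ δ > (0:ℝ), ∃ N : ℕ, ∃ c > (0:ℝ),
      ∀ (ν : Measure (OmegaL d m L)), IsProbabilityMeasure ν →
        (∃ K : Set (OmegaL d m L), IsCompact K ∧ ν Kᶜ = 0) →
        W1rho (fun x y => qpcDist x.val y.val) ν ν₀ < δ →
        ∀ (νZ : Measure (ℤ → OmegaL d m L)), IsBernoulli ν νZ →
          ∀ θ : Td d, ∀ n : ℕ, N ≤ n →
            νZ {ω : ℤ → OmegaL d m L |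
                ℓ₀ + ε ≤ (1 / (n : ℝ)) *
                  Real.log (matOpNorm (cocycleIter ω n θ))} <
              ENNReal.ofReal (Real.exp (-c * n)) := by
  intro ε hε
  have := hν₀Z.1
  have hC : 0 ≤ Real.posLog L := Real.posLog_nonneg
  simp only [QPCocycle.integral_log_cocycleIter hν₀Z] at hℓ₀
  have hℓ₀0 : 0 ≤ ℓ₀ := ge_of_tendsto' hℓ₀ fun n =>
    mul_nonneg (by positivity) (integral_nonneg (QPCocycle.growth_nonneg ν₀ n))
  obtain ⟨n₀, hn₀, hn₀pos⟩ := ((hℓ₀.eventually_lt_const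
    (by linarith : ℓ₀ < ℓ₀ + ε / 8)).and (eventually_gt_atTop 0)).exists
  have hn₀' : (0 : ℝ) < n₀ := by exact_mod_cast hn₀pos
  rw [one_div, inv_mul_lt_iff₀ hn₀'] at hn₀
  obtain ⟨n₁, hn₁, hg⟩ := QPCocycle.exists_growth_le hν₀Z herg hn₀pos hn₀.le
    (by positivity : 0 < ε / 8)
  obtain ⟨δ, hδ, hpert⟩ := QPCocycle.stepOp_pow_perturb ν₀ (QPCocycle.logNorm d m) n₁ 1
    (by positivity : 0 < ε / 4)
  have hn₁' : (1 : ℝ) ≤ n₁ := by exact_mod_cast hn₁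
  set D := n₁ * Real.posLog L with hD
  have hD0 : 0 ≤ D := by positivity
  obtain ⟨t, ht, htD, htD2⟩ : ∃ t > 0, t * D ≤ 1 ∧ t * D ^ 2 ≤ ε / 4 := by
    refine ⟨min (1 / (D + 1)) (ε / 4 / (D ^ 2 + 1)), by positivity, ?_, ?_⟩
    · refine (mul_le_mul_of_nonneg_right (min_le_left _ _) hD0).trans ?_
      rw [one_div, inv_mul_le_iff₀ (by positivity)]
      linarith
    · refine (mul_le_mul_of_nonneg_right (min_le_right _ _) (sq_nonneg D)).trans ?_
      rw [div_mul_eq_mul_div, div_le_iff₀ (by positivity)]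
      nlinarith
  obtain ⟨N, hN⟩ := exists_nat_gt (8 * D / ε)
  refine ⟨δ, hδ, N, t * ε / 8, by positivity, fun ν hν _ hW νZ hνZ θ n hn => ?_⟩
  have hNn : (N : ℝ) ≤ n := by exact_mod_cast hn
  have hnD : 8 * D < n * ε := by
    rw [div_lt_iff₀ hε] at hN
    nlinarith
  have hnpos : (0 : ℝ) < n := pos_of_mul_pos_left (by linarith) hε.le
  have hgν : ∀ θ, QPCocycle.growth ν n₁ θ ≤ n₁ * (ℓ₀ + ε / 2) := fun θ => by
    have h1 := hpert ν hW (θ, 1) ContinuousLinearMap.norm_id_le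
    rw [← QPCocycle.growth_apply, ← QPCocycle.growth_apply] at h1
    have h2 := hg θ
    nlinarith
  have hblock : ∀ θ, (QPCocycle.stepOp ℝ ν ^ n₁) (QPCocycle.expNorm d m t) (θ, 1) ≤
      Real.exp (t * (n₁ * (ℓ₀ + 3 * ε / 4))) := fun θ => by
    refine (QPCocycle.expNorm_le hνZ ht.le (hgν θ) htD).trans (Real.exp_le_exp.2 ?_)
    rw [← hD]
    have h1 : t * (t * D ^ 2) ≤ t * (n₁ * (ε / 4)) := by
      refine mul_le_mul_of_nonneg_left (htD2.trans ?_) ht.le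
      exact le_mul_of_one_le_left (by positivity) hn₁'
    nlinarith
  have hmgf := QPCocycle.expNorm_le_of_block hνZ hn₁ ht.le (by positivity) hblock n θ
  have hcher := QPCocycle.measure_le_logNorm_orb_le hνZ (x := n * (ℓ₀ + ε)) ht.le hmgf
  have hset : {ω : ℤ → OmegaL d m L | ℓ₀ + ε ≤ (1 / (n : ℝ)) *
      Real.log (matOpNorm (cocycleIter ω n θ))} =
      {ω | n * (ℓ₀ + ε) ≤ QPCocycle.logNorm d m (QPCocycle.orb θ ω n)} := by
    ext ω
    rw [Set.mem_ofPred_eq, Set.mem_ofPred_eq, QPCocycle.log_matOpNorm_cocycleIter, one_div,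
      le_inv_mul_iff₀ hnpos]
  rw [hset]
  refine hcher.trans_lt ((ENNReal.ofReal_lt_ofReal_iff (Real.exp_pos _)).2 (Real.exp_lt_exp.2 ?_))
  rw [← hD]
  have h1 := mul_lt_mul_of_pos_left hnD ht
  nlinarith
end
end
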